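/- arXiv:2503.17541 — 2 statements merged into one kernel-verified Lean document; each statement's English description precedes it below -/
import Mathlib

section
/- Let S = k[x_1,…,x_n] be a (possibly nonstandard) positively Z-graded polynomial ring over a field k with graded maximal ideal m = (x_1,…,x_n). Then for every integer e, the truncation S_{≥e} is a nonstandard Koszul S-module; that is, the associated graded module gr_m(S_{≥e}) has a linear resolution over the standard graded ring gr_m(S). -/
/-!
Background setup.  `MvPolynomial (Fin n) k` is the polynomial ring `S = k[x_1, …, x_n]`
over the field `k`, graded (possibly nonstandardly) by weights `w : Fin n → ℤ` with
`0 < w i`, with graded maximal ideal `m = maxIdeal k n = (x_1, …, x_n)`.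

* `trunc k n w e` is the truncation `S_{≥e} = ⊕_{i ≥ e} S_i`, an `S`-submodule of `S`
  (realized as the `S`-span of the weighted-homogeneous elements of weighted degree `≥ e`;
  for positive weights this span is exactly `⊕_{i ≥ e} S_i`).
* `GrRing k n` is the associated graded ring `gr_m(S) = ⊕_{i≥0} m^i/m^{i+1}`, realized
  as the quotient `Rees(m) ⧸ m·Rees(m)` of the Rees algebra of `m`; it is a standard
  graded polynomial ring over `k = S/m`.
* `GrMod k n M` is the associated graded module `gr_m(M) = ⊕_{i≥0} m^i M/m^{i+1} M` of an
  `S`-module `M`, realized as the quotient of the Rees module `⊕_i m^i M` by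
  `m·(⊕_i m^i M)`; it is a module over `gr_m(S) = GrRing k n`.
* `grDeg1 k n` is the degree-one component `m/m²` of `gr_m(S)`, i.e. the set of linear
  forms of the standard graded ring `gr_m(S)`.
* `HasLinearResolution R Lin N` says that `N` admits a free resolution
  `⋯ → F_{i+1} → F_i → ⋯ → F_0 → N → 0` in which every differential is given by a matrix
  all of whose entries lie in the set `Lin` of linear forms.  For a module generated in
  degree `0` over a standard graded `k`-algebra `R` (with `Lin = R_1`) this is the usual
  notion of a linear resolution: a graded free resolution `F_•` with `F_i` generated in
  degree `i`.
-/

set_option synthInstance.maxHeartbeats 1000000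
set_option maxHeartbeats 1000000

noncomputable section
open MvPolynomial

/-- The graded maximal ideal `m = (x_1, …, x_n)` of `S = k[x_1, …, x_n]`. -/
def maxIdeal (k : Type) [Field k] (n : ℕ) : Ideal (MvPolynomial (Fin n) k) :=
  Ideal.span (Set.range MvPolynomial.X)

/-- The truncation `S_{≥e} = ⊕_{i ≥ e} S_i` of the `ℤ`-graded polynomial ring `S` with
weights `w`. -/
def trunc (k : Type) [Field k] (n : ℕ) (w : Fin n → ℤ) (e : ℤ) :
    Submodule (MvPolynomial (Fin n) k) (MvPolynomial (Fin n) k) :=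
  Submodule.span _ (⋃ (d : ℤ) (_ : e ≤ d),
    (MvPolynomial.weightedHomogeneousSubmodule k w d : Set (MvPolynomial (Fin n) k)))

/-- The ideal `m·Rees(m)` of the Rees algebra `Rees(m)`; the quotient by it is `gr_m(S)`. -/
def grIdeal (k : Type) [Field k] (n : ℕ) : Ideal ↥(reesAlgebra (maxIdeal k n)) :=
  (maxIdeal k n).map (algebraMap (MvPolynomial (Fin n) k) ↥(reesAlgebra (maxIdeal k n)))

/-- The associated graded ring `gr_m(S) = ⊕_{i≥0} m^i/m^{i+1} = Rees(m)/m·Rees(m)`. -/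
abbrev GrRing (k : Type) [Field k] (n : ℕ) : Type :=
  ↥(reesAlgebra (maxIdeal k n)) ⧸ grIdeal k n

variable (k : Type) [Field k] (n : ℕ) (M : Type) [AddCommGroup M]
  [Module (MvPolynomial (Fin n) k) M]

/-- The Rees module `⊕_i m^i M` of an `S`-module `M`, a module over the Rees algebra. -/
def ReesMod : Type :=
  ↥(((maxIdeal k n).stableFiltration (⊤ : Submodule (MvPolynomial (Fin n) k) M)).submodule)

instance : AddCommGroup (ReesMod k n M) := by unfold ReesMod; infer_instance
instance : Module ↥(reesAlgebra (maxIdeal k n)) (ReesMod k n M) := by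
  unfold ReesMod; infer_instance

/-- The associated graded module `gr_m(M) = ⊕_{i≥0} m^i M/m^{i+1} M`, realized as the
quotient of the Rees module `⊕_i m^i M` by `m·(⊕_i m^i M)`; a `gr_m(S)`-module. -/
def GrMod : Type :=
  ReesMod k n M ⧸
    ((grIdeal k n) • (⊤ : Submodule ↥(reesAlgebra (maxIdeal k n)) (ReesMod k n M)))

instance : AddCommGroup (GrMod k n M) := by unfold GrMod; infer_instance
instance : Module (GrRing k n) (GrMod k n M) := by unfold GrMod; infer_instance

/-- The degree-one component `m/m²` of `gr_m(S)`: the set of (classes of) the degree-one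
elements `s·t` (`s ∈ m`) of the Rees algebra, i.e. the linear forms of `gr_m(S)`. -/
def grDeg1 : Set (GrRing k n) :=
  {g | ∃ s, ∃ hs : s ∈ maxIdeal k n, g = Ideal.Quotient.mk (grIdeal k n)
      ⟨Polynomial.monomial 1 s, reesAlgebra.monomial_mem.mpr (by simpa using hs)⟩}

/-- `N` has a **linear resolution** over `R` with respect to the set `Lin ⊆ R` of linear
forms (the degree-one component of the standard graded algebra `R`): there is a free
resolution `⋯ → F_{i+1} → F_i → ⋯ → F_0 → N → 0` in which every differential is given by
a matrix with all entries in `Lin`.  For `N` generated in degree `0` this is the usual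
notion of a linear resolution (`F_i` generated in degree `i`). -/
def HasLinearResolution (R : Type*) [CommRing R] (Lin : Set R)
    (N : Type*) [AddCommGroup N] [Module R N] : Prop :=
  ∃ (κ : ℕ → Type) (d : ∀ i : ℕ, (κ (i + 1) →₀ R) →ₗ[R] (κ i →₀ R))
    (ε : (κ 0 →₀ R) →ₗ[R] N),
      Function.Surjective ε ∧
      LinearMap.range (d 0) = LinearMap.ker ε ∧
      (∀ i, LinearMap.range (d (i + 1)) = LinearMap.ker (d i)) ∧
      (∀ i (a : κ (i + 1)) (b : κ i), d i (Finsupp.single a 1) b ∈ Lin)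

namespace LinearTruncation

section FreeModules

variable {k : Type} [Field k] {n : ℕ} {κ κ' : Type}

/-- The degree `j` component of a vector of polynomials. -/
def comp (κ : Type) (j : ℕ) :
    (κ →₀ MvPolynomial (Fin n) k) →ₗ[k] (κ →₀ MvPolynomial (Fin n) k) :=
  Finsupp.mapRange.linearMap (homogeneousComponent j)

@[simp] lemma comp_apply (j : ℕ) (f : κ →₀ MvPolynomial (Fin n) k) (b : κ) :
    comp κ j f b = homogeneousComponent j (f b) := by
  simp [comp]

lemma homogeneousComponent_mul_of_isHomogeneous {v : MvPolynomial (Fin n) k} {t : ℕ}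
    (hv : v.IsHomogeneous t) (p : MvPolynomial (Fin n) k) (j : ℕ) :
    homogeneousComponent j (p * v) =
      if t ≤ j then homogeneousComponent (j - t) p * v else 0 := by
  conv_lhs => rw [← sum_homogeneousComponent p, Finset.sum_mul, map_sum]
  have key : ∀ i, homogeneousComponent j (homogeneousComponent i p * v) =
      if j = i + t then homogeneousComponent i p * v else 0 := fun i =>
    homogeneousComponent_of_mem
      ((homogeneousComponent_isHomogeneous i p).mul hv)
  simp_rw [key]
  split_ifs with h
  · rw [Finset.sum_eq_single (j - t)]
    · rw [if_pos (by omega)]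
    · intro i _ hi
      rw [if_neg (by omega)]
    · intro hi
      rw [if_pos (by omega), homogeneousComponent_eq_zero _ _ (by simp at hi; omega), zero_mul]
  · exact Finset.sum_eq_zero fun i _ => if_neg (by omega)

lemma comp_comp (i j : ℕ) (f : κ →₀ MvPolynomial (Fin n) k) :
    comp κ i (comp κ j f) = if i = j then comp κ j f else 0 := by
  ext1 b
  rw [comp_apply, homogeneousComponent_of_mem (m := i) (n := j)]
  · split_ifs <;> simp
  · simpa using homogeneousComponent_isHomogeneous j (f b)

@[simp] lemma comp_comp_self (j : ℕ) (f : κ →₀ MvPolynomial (Fin n) k) :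
    comp κ j (comp κ j f) = comp κ j f := by
  simp [comp_comp]

lemma isHomogeneous_of_comp_eq {j : ℕ} {f : κ →₀ MvPolynomial (Fin n) k} (h : comp κ j f = f)
    (b : κ) : (f b).IsHomogeneous j := by
  rw [← h, comp_apply]
  exact homogeneousComponent_isHomogeneous j _

lemma comp_smul {v : κ →₀ MvPolynomial (Fin n) k} {t : ℕ} (hv : comp κ t v = v)
    (p : MvPolynomial (Fin n) k) (j : ℕ) :
    comp κ j (p • v) = if t ≤ j then homogeneousComponent (j - t) p • v else 0 := by
  ext1 b
  rw [comp_apply, Finsupp.smul_apply, smul_eq_mul,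
    homogeneousComponent_mul_of_isHomogeneous (isHomogeneous_of_comp_eq hv b)]
  split_ifs <;> simp

lemma comp_X_smul (s : Fin n) (f : κ →₀ MvPolynomial (Fin n) k) (j : ℕ) :
    comp κ (j + 1) ((X s : MvPolynomial (Fin n) k) • f) =
      (X s : MvPolynomial (Fin n) k) • comp κ j f := by
  ext1 b
  rw [comp_apply, Finsupp.smul_apply, smul_eq_mul, mul_comm,
    homogeneousComponent_mul_of_isHomogeneous (isHomogeneous_X k s)]
  simp [mul_comm]

lemma exists_sum_comp (f : κ →₀ MvPolynomial (Fin n) k) :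
    ∃ N : ℕ, ∑ j ∈ Finset.range N, comp κ j f = f := by
  refine ⟨f.support.sup (fun b => (f b).totalDegree) + 1, ?_⟩
  ext1 b
  rw [Finsupp.finsetSum_apply]
  simp only [comp_apply]
  by_cases hb : b ∈ f.support
  · conv_rhs => rw [← sum_homogeneousComponent (f b)]
    symm
    apply Finset.sum_subset
    · intro i hi
      have := Finset.le_sup (f := fun b => (f b).totalDegree) hb
      simp only [Finset.mem_range] at hi ⊢
      omega
    · intro i _ hi
      exact homogeneousComponent_eq_zero _ _ (by simpa using hi)
  · simp [Finsupp.notMem_support_iff.mp hb]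

lemma mem_of_comp_mem {L : Submodule (MvPolynomial (Fin n) k) (κ →₀ MvPolynomial (Fin n) k)}
    {f : κ →₀ MvPolynomial (Fin n) k} (h : ∀ j, comp κ j f ∈ L) : f ∈ L := by
  obtain ⟨N, hN⟩ := exists_sum_comp f
  rw [← hN]
  exact Submodule.sum_mem _ fun j _ => h j

/-- The ideal generated by the first `i` variables in the order given by `σ`. -/
def varIdeal (k : Type) [Field k] (σ : Equiv.Perm (Fin n)) (i : ℕ) :
    Ideal (MvPolynomial (Fin n) k) :=
  Ideal.span (X '' {s | (σ.symm s : ℕ) < i})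

variable (σ : Equiv.Perm (Fin n))

lemma varIdeal_zero : varIdeal k σ 0 = ⊥ := by
  simp [varIdeal]

lemma varIdeal_succ (i : Fin n) :
    varIdeal k σ (i + 1) = Ideal.span {X (σ i)} ⊔ varIdeal k σ i := by
  rw [varIdeal, varIdeal, ← Ideal.span_union, ← Set.image_singleton, ← Set.image_union]
  congr 2
  ext s
  simp only [Set.mem_ofPred_eq, Set.mem_union, Set.mem_singleton_iff]
  rw [← Equiv.symm_apply_eq, Fin.ext_iff]
  omega

variable {σ} in
lemma comp_succ_mem_varIdeal_smul {i : ℕ}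
    {K L : Submodule (MvPolynomial (Fin n) k) (κ →₀ MvPolynomial (Fin n) k)} {j : ℕ}
    (hKL : ∀ f ∈ K, comp κ j f ∈ L) {f : κ →₀ MvPolynomial (Fin n) k}
    (hf : f ∈ varIdeal k σ i • K) : comp κ (j + 1) f ∈ varIdeal k σ i • L := by
  induction hf using Submodule.smul_induction_on' with
  | smul r hr m hm =>
    induction hr using Submodule.span_induction generalizing m with
    | mem x hx =>
      have hx' := hx
      obtain ⟨s, hs, rfl⟩ := hx'
      rw [comp_X_smul]
      exact Submodule.smul_mem_smul (Ideal.subset_span hx) (hKL _ hm)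
    | zero => simp
    | add x y _ _ hx hy =>
      rw [add_smul, map_add]
      exact Submodule.add_mem _ (hx m hm) (hy m hm)
    | smul a x _ hx =>
      rw [smul_eq_mul, mul_comm, mul_smul]
      exact hx _ (K.smul_mem _ hm)
  | add x _ y _ hx hy =>
    rw [map_add]
    exact Submodule.add_mem _ hx hy

lemma mem_varIdeal_smul_top {i : ℕ} {f : κ →₀ MvPolynomial (Fin n) k} :
    f ∈ varIdeal k σ i • (⊤ : Submodule (MvPolynomial (Fin n) k) (κ →₀ MvPolynomial (Fin n) k)) ↔
      ∀ b, f b ∈ varIdeal k σ i := by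
  constructor
  · intro hf b
    induction hf using Submodule.smul_induction_on' with
    | smul r hr m _ => exact Ideal.mul_mem_right _ _ hr
    | add x _ y _ hx hy => exact Ideal.add_mem _ hx hy
  · intro hf
    rw [← f.sum_single]
    refine Submodule.sum_mem _ fun b _ => ?_
    rw [← mul_one (f b), ← smul_eq_mul, ← Finsupp.smul_single]
    exact Submodule.smul_mem_smul (hf b) trivial

lemma mem_varIdeal_of_X_mul_mem {i : Fin n} {p : MvPolynomial (Fin n) k}
    (h : X (σ i) * p ∈ varIdeal k σ i) : p ∈ varIdeal k σ i := by
  rw [varIdeal, mem_ideal_span_X_image] at h ⊢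
  intro m hm
  obtain ⟨s, hs, hs'⟩ := h (Finsupp.single (σ i) 1 + m) (by
    rw [mem_support_iff] at hm ⊢
    rwa [coeff_X_mul])
  refine ⟨s, hs, ?_⟩
  have : σ i ≠ s := by
    rintro rfl
    simp at hs
  simpa [this] using hs'

/-- The conditions on a submodule `K` of a free module `F` (with basis in degree `0`) ensuring that
the minimal free resolution of `F ⧸ K` is linear: `K` is homogeneous, concentrated in positive
degrees, and each variable is, in positive degrees, a nonzerodivisor on `F ⧸ K` modulo the previous
variables. -/
structure IsLinearRelations
    (K : Submodule (MvPolynomial (Fin n) k) (κ →₀ MvPolynomial (Fin n) k)) : Prop where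
  comp_mem : ∀ f ∈ K, ∀ j, comp κ j f ∈ K
  comp_zero : ∀ f ∈ K, comp κ 0 f = 0
  mem_of_X_smul_mem : ∀ (i : Fin n) (j : ℕ) (a : κ →₀ MvPolynomial (Fin n) k),
    comp κ (j + 1) a = a →
    (X (σ i) : MvPolynomial (Fin n) k) • a ∈ varIdeal k σ i • ⊤ ⊔ K →
    a ∈ varIdeal k σ i • ⊤ ⊔ K

variable {σ}
variable {K : Submodule (MvPolynomial (Fin n) k) (κ →₀ MvPolynomial (Fin n) k)}

lemma IsLinearRelations.mem_varIdeal_smul (hK : IsLinearRelations σ K) {i : ℕ} (hi : i ≤ n)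
    {j : ℕ} {f : κ →₀ MvPolynomial (Fin n) k} (hf : comp κ (j + 2) f = f)
    (hfI : f ∈ varIdeal k σ i •
      (⊤ : Submodule (MvPolynomial (Fin n) k) (κ →₀ MvPolynomial (Fin n) k)))
    (hfK : f ∈ K) : f ∈ varIdeal k σ i • K := by
  induction i generalizing f with
  | zero => simpa [varIdeal_zero] using hfI
  | succ i ih =>
    have hsucc := varIdeal_succ (k := k) σ ⟨i, hi⟩
    simp only at hsucc
    rw [hsucc, Submodule.sup_smul, Submodule.ideal_span_singleton_smul, Submodule.mem_sup] at hfI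
    obtain ⟨y, hy, b, hb, hyb⟩ := hfI
    obtain ⟨a, -, rfl⟩ := (Submodule.mem_smul_pointwise_iff_exists _ _ _).mp hy
    have htop := fun (g : κ →₀ MvPolynomial (Fin n) k)
      (hg : g ∈ varIdeal k σ i •
        (⊤ : Submodule (MvPolynomial (Fin n) k) (κ →₀ MvPolynomial (Fin n) k))) j =>
      comp_succ_mem_varIdeal_smul (fun _ _ => Submodule.mem_top) hg (j := j)
    have hdec := congrArg (comp κ (j + 2)) hyb
    rw [hf, map_add, comp_X_smul] at hdec
    have hXa : (X (σ ⟨i, hi⟩) : MvPolynomial (Fin n) k) • comp κ (j + 1) a ∈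
        varIdeal k σ i • ⊤ ⊔ K := by
      rw [eq_sub_of_add_eq hdec]
      exact Submodule.sub_mem _ (Submodule.mem_sup_right hfK)
        (Submodule.mem_sup_left (htop b hb (j + 1)))
    obtain ⟨a', ha', c, hc, hac⟩ := Submodule.mem_sup.mp
      (hK.mem_of_X_smul_mem ⟨i, hi⟩ j _ (comp_comp_self _ _) hXa)
    have hac' := congrArg (comp κ (j + 1)) hac
    rw [comp_comp_self, map_add] at hac'
    have hcK := hK.comp_mem c hc (j + 1)
    have hrest : f - (X (σ ⟨i, hi⟩) : MvPolynomial (Fin n) k) • comp κ (j + 1) c =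
        (X (σ ⟨i, hi⟩) : MvPolynomial (Fin n) k) • comp κ (j + 1) a' + comp κ (j + 2) b := by
      rw [← hdec, ← hac', smul_add]
      abel
    have hmem := ih (by omega) (f := f - (X (σ ⟨i, hi⟩) : MvPolynomial (Fin n) k) •
        comp κ (j + 1) c) (by rw [map_sub, hf, comp_X_smul, comp_comp_self])
      (by
        rw [hrest]
        exact Submodule.add_mem _ (Submodule.smul_mem _ _ (htop a' ha' j)) (htop b hb (j + 1)))
      (Submodule.sub_mem _ hfK (Submodule.smul_mem _ _ hcK))
    rw [hsucc, Submodule.sup_smul, Submodule.ideal_span_singleton_smul]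
    rw [← sub_add_cancel f ((X (σ ⟨i, hi⟩) : MvPolynomial (Fin n) k) • comp κ (j + 1) c)]
    exact Submodule.add_mem _ (Submodule.mem_sup_right hmem) (Submodule.mem_sup_left
      (Submodule.smul_mem_pointwise_smul _ _ _ hcK))

/-- The linear elements of `K`, as a `k`-vector space. -/
def linearPart (K : Submodule (MvPolynomial (Fin n) k) (κ →₀ MvPolynomial (Fin n) k)) :
    Submodule k (κ →₀ MvPolynomial (Fin n) k) :=
  K.restrictScalars k ⊓ LinearMap.ker (comp κ 1 - LinearMap.id)

lemma mem_linearPart {f : κ →₀ MvPolynomial (Fin n) k} :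
    f ∈ linearPart K ↔ f ∈ K ∧ comp κ 1 f = f := by
  simp [linearPart, sub_eq_zero]

lemma mem_varIdeal_of_isHomogeneous {p : MvPolynomial (Fin n) k} {j : ℕ}
    (hp : p.IsHomogeneous (j + 1)) : p ∈ varIdeal k σ n := by
  rw [varIdeal, mem_ideal_span_X_image]
  intro m hm
  have hdeg := hp (mem_support_iff.mp hm)
  have hm0 : m ≠ 0 := by
    rintro rfl
    simp at hdeg
  obtain ⟨s, hs⟩ := Finsupp.ne_iff.mp hm0
  exact ⟨s, (σ.symm s).2, by simpa using hs⟩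

lemma IsLinearRelations.le_span_linearPart (hK : IsLinearRelations σ K) :
    K ≤ Submodule.span (MvPolynomial (Fin n) k) (linearPart K : Set _) := by
  have key : ∀ j, ∀ f ∈ K, comp κ j f ∈ Submodule.span (MvPolynomial (Fin n) k)
      (linearPart K : Set (κ →₀ MvPolynomial (Fin n) k)) := by
    intro j
    induction j with
    | zero =>
      intro f hf
      rw [hK.comp_zero f hf]
      exact Submodule.zero_mem _
    | succ j ih =>
      intro f hf
      rcases j with _ | j
      · exact Submodule.subset_span (mem_linearPart.mpr ⟨hK.comp_mem f hf 1, comp_comp_self 1 f⟩)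
      · have hmem := hK.mem_varIdeal_smul le_rfl (comp_comp_self (j + 2) f)
          (mem_varIdeal_smul_top σ |>.mpr fun b => mem_varIdeal_of_isHomogeneous
            (isHomogeneous_of_comp_eq (comp_comp_self (j + 2) f) b)) (hK.comp_mem f hf _)
        rw [← comp_comp_self]
        exact Submodule.smul_le_right (comp_succ_mem_varIdeal_smul ih hmem)
  exact fun f hf => mem_of_comp_mem fun j => key j f hf

/-- The index type of a basis of the space of linear elements of `K`. -/
def LinearIndex (K : Submodule (MvPolynomial (Fin n) k) (κ →₀ MvPolynomial (Fin n) k)) : Type :=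
  Module.Basis.ofVectorSpaceIndex k (linearPart K)

/-- A basis of the space of linear elements of `K`. -/
def linearBasis (K : Submodule (MvPolynomial (Fin n) k) (κ →₀ MvPolynomial (Fin n) k)) :
    Module.Basis (LinearIndex K) k (linearPart K) :=
  Module.Basis.ofVectorSpace k (linearPart K)

/-- The free cover of the submodule generated by the linear elements of `K`. -/
def linearCover (K : Submodule (MvPolynomial (Fin n) k) (κ →₀ MvPolynomial (Fin n) k)) :
    (LinearIndex K →₀ MvPolynomial (Fin n) k) →ₗ[MvPolynomial (Fin n) k]
      (κ →₀ MvPolynomial (Fin n) k) :=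
  Finsupp.linearCombination _ fun a => (linearBasis K a : κ →₀ MvPolynomial (Fin n) k)

lemma linearCover_single_one (a : LinearIndex K) :
    linearCover K (Finsupp.single a 1) = linearBasis K a := by
  simp [linearCover]

lemma comp_linearBasis (a : LinearIndex K) :
    comp κ 1 (linearBasis K a : κ →₀ MvPolynomial (Fin n) k) = linearBasis K a :=
  (mem_linearPart.mp (linearBasis K a).2).2

lemma IsLinearRelations.range_linearCover (hK : IsLinearRelations σ K) :
    LinearMap.range (linearCover K) = K := by
  rw [linearCover, Finsupp.range_linearCombination]
  apply le_antisymm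
  · rw [Submodule.span_le]
    rintro _ ⟨a, rfl⟩
    exact (mem_linearPart.mp (linearBasis K a).2).1
  · refine hK.le_span_linearPart.trans ?_
    rw [Submodule.span_le]
    intro f hf
    have hrepr := congrArg (linearPart K).subtype ((linearBasis K).linearCombination_repr ⟨f, hf⟩)
    rw [Finsupp.linearCombination_apply, map_finsuppSum] at hrepr
    simp only [map_smul, Submodule.subtype_apply] at hrepr
    rw [← hrepr]
    refine Submodule.sum_mem _ fun a _ => ?_
    exact Submodule.smul_of_tower_mem _ _ (Submodule.subset_span ⟨a, rfl⟩)

lemma comp_succ_linearCover (f : LinearIndex K →₀ MvPolynomial (Fin n) k) (j : ℕ) :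
    comp κ (j + 1) (linearCover K f) = linearCover K (comp _ j f) := by
  induction f using Finsupp.induction_linear with
  | zero => simp
  | add f g hf hg => simp only [map_add, hf, hg]
  | single a p =>
    have : comp _ j (Finsupp.single a p) = Finsupp.single a (homogeneousComponent j p) := by
      simp [comp]
    rw [this, linearCover, Finsupp.linearCombination_single, Finsupp.linearCombination_single,
      comp_smul (comp_linearBasis a)]
    simp

lemma comp_zero_eq_zero_of_linearCover {f : LinearIndex K →₀ MvPolynomial (Fin n) k}
    (hf : linearCover K (comp _ 0 f) = 0) : comp _ 0 f = 0 := by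
  let c : LinearIndex K →₀ k := f.mapRange (coeff 0) (by simp)
  have hfc : comp _ 0 f = c.mapRange C (by simp) := by
    ext1 b
    rw [comp_apply, Finsupp.mapRange_apply, homogeneousComponent_zero]
    rfl
  have hc : (linearPart K).subtype (Finsupp.linearCombination k (linearBasis K) c) = 0 := by
    rw [← hf, hfc, linearCover, Finsupp.linearCombination_apply, Finsupp.linearCombination_apply,
      Finsupp.sum_mapRange_index (by simp), map_finsuppSum]
    refine Finsupp.sum_congr fun a _ => ?_
    rw [← algebraMap_eq, algebraMap_smul, map_smul]
    rfl
  have hc0 : c = 0 := by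
    have hc' : Finsupp.linearCombination k (linearBasis K) c = 0 :=
      (linearPart K).injective_subtype (hc.trans (map_zero _).symm)
    exact (linearBasis K).linearIndependent (hc'.trans (map_zero _).symm)
  rw [hfc, hc0]
  simp

lemma IsLinearRelations.ker_linearCover (hK : IsLinearRelations σ K) :
    IsLinearRelations σ (LinearMap.ker (linearCover K)) where
  comp_mem f hf j := by
    rw [LinearMap.mem_ker] at hf ⊢
    rw [← comp_succ_linearCover, hf, map_zero]
  comp_zero f hf := by
    rw [LinearMap.mem_ker] at hf
    apply comp_zero_eq_zero_of_linearCover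
    rw [← comp_succ_linearCover, hf, map_zero]
  mem_of_X_smul_mem i j a ha hXa := by
    have hmap : ∀ x, x ∈ varIdeal k σ i • (⊤ : Submodule (MvPolynomial (Fin n) k) _) ⊔
        LinearMap.ker (linearCover K) ↔ linearCover K x ∈ varIdeal k σ i • K := by
      intro x
      rw [← Submodule.comap_map_eq, Submodule.mem_comap, Submodule.map_smul'', Submodule.map_top,
        hK.range_linearCover]
    rw [hmap] at hXa ⊢
    have haK : linearCover K a ∈ K :=
      hK.range_linearCover.le (LinearMap.mem_range_self _ _)
    refine hK.mem_varIdeal_smul i.2.le (j := j) (by rw [comp_succ_linearCover, ha]) ?_ haK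
    rw [mem_varIdeal_smul_top]
    intro b
    apply mem_varIdeal_of_X_mul_mem
    rw [map_smul] at hXa
    exact (mem_varIdeal_smul_top σ).mp (Submodule.smul_mono le_rfl le_top hXa) b

/-- A linear presentation datum: a free module together with a submodule of linear relations. -/
structure LinearRelations (k : Type) [Field k] {n : ℕ} (σ : Equiv.Perm (Fin n)) where
  index : Type
  relations : Submodule (MvPolynomial (Fin n) k) (index →₀ MvPolynomial (Fin n) k)
  isLinearRelations : IsLinearRelations σ relations

/-- The relations among the linear generators of the given relations. -/
def LinearRelations.next (D : LinearRelations k σ) : LinearRelations k σ where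
  index := LinearIndex D.relations
  relations := LinearMap.ker (linearCover D.relations)
  isLinearRelations := D.isLinearRelations.ker_linearCover

theorem IsLinearRelations.hasLinearResolution (hK : IsLinearRelations σ K) {N : Type*}
    [AddCommGroup N] [Module (MvPolynomial (Fin n) k) N]
    (ε : (κ →₀ MvPolynomial (Fin n) k) →ₗ[MvPolynomial (Fin n) k] N)
    (hε : Function.Surjective ε) (hεK : LinearMap.ker ε = K) :
    HasLinearResolution (MvPolynomial (Fin n) k) {p | p.IsHomogeneous 1} N := by
  let D : ℕ → LinearRelations k σ := fun i =>
    Nat.rec ⟨κ, K, hK⟩ (fun _ D => D.next) i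
  refine ⟨fun i => (D i).index, fun i => linearCover (D i).relations, ε, hε, ?_, ?_, ?_⟩
  · rw [hεK]
    exact hK.range_linearCover
  · exact fun i => (D (i + 1)).isLinearRelations.range_linearCover
  · intro i a b
    have h1 : ∀ a' : LinearIndex (D i).relations,
        (linearCover (D i).relations (Finsupp.single a' 1) b).IsHomogeneous 1 := fun a' => by
      rw [linearCover_single_one]
      exact isHomogeneous_of_comp_eq (comp_linearBasis a') b
    exact h1 a

end FreeModules
section Monomials

variable {n : ℕ}

/-- The monomials of order at least `i` in the truncation: those that remain of weight at least `e`
after division by some monomial of degree at least `i`. -/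
def orderGE (w : Fin n → ℤ) (e : ℤ) (i : ℕ) : Set (Fin n →₀ ℕ) :=
  {u | ∃ v g : Fin n →₀ ℕ, u = v + g ∧ i ≤ v.degree ∧ e ≤ Finsupp.weight w g}

variable {w : Fin n → ℤ} {e : ℤ}

lemma exists_eq_single_add {u : Fin n →₀ ℕ} {s : Fin n} (h : u s ≠ 0) :
    ∃ u', u = Finsupp.single s 1 + u' :=
  ⟨u - Finsupp.single s 1, (add_tsub_cancel_of_le
    (Finsupp.single_le_iff.mpr (Nat.one_le_iff_ne_zero.mpr h))).symm⟩

lemma exists_ne_zero_of_degree_pos {u : Fin n →₀ ℕ} (h : 0 < u.degree) : ∃ s, u s ≠ 0 := by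
  have : u ≠ 0 := by
    rintro rfl
    simp at h
  simpa using Finsupp.ne_iff.mp this

lemma mem_orderGE_of_single_add {u : Fin n →₀ ℕ} {t : Fin n} {j : ℕ}
    (hu : ∀ s, u s ≠ 0 → w t ≤ w s) (h : Finsupp.single t 1 + u ∈ orderGE w e (j + 2)) :
    u ∈ orderGE w e (j + 1) := by
  obtain ⟨v, g, huvg, hv, hg⟩ := h
  by_cases hvt : v t = 0
  · have hgt : g t ≠ 0 := by
      have := DFunLike.congr_fun huvg t
      simp only [Finsupp.add_apply, Finsupp.single_eq_same] at this
      omega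
    obtain ⟨g', rfl⟩ := exists_eq_single_add hgt
    have hu' : u = v + g' := by
      rw [add_left_comm] at huvg
      exact add_left_cancel huvg
    obtain ⟨s, hs⟩ := exists_ne_zero_of_degree_pos (u := v) (by omega)
    obtain ⟨v', rfl⟩ := exists_eq_single_add hs
    have hts := hu s (by simp [hu'])
    refine ⟨v', Finsupp.single s 1 + g', ?_, ?_, ?_⟩
    · rw [hu']; abel
    · rw [map_add, Finsupp.degree_single] at hv
      omega
    · rw [map_add, Finsupp.weight_single] at hg ⊢
      simp only [one_smul] at hg ⊢
      omega
  · obtain ⟨v', rfl⟩ := exists_eq_single_add hvt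
    refine ⟨v', g, ?_, ?_, hg⟩
    · rw [add_assoc] at huvg
      exact add_left_cancel huvg
    · rw [map_add, Finsupp.degree_single] at hv
      omega

lemma exists_decomposition {u : Fin n →₀ ℕ} {j : ℕ} (hu : u ∈ orderGE w e j)
    (hu' : u ∉ orderGE w e (j + 1)) :
    ∃ v g, u = v + g ∧ v.degree = j ∧ e ≤ Finsupp.weight w g ∧ g ∉ orderGE w e 1 := by
  obtain ⟨v, g, rfl, hv, hg⟩ := hu
  refine ⟨v, g, rfl, ?_, hg, ?_⟩
  · by_contra hne
    exact hu' ⟨v, g, rfl, by omega, hg⟩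
  · rintro ⟨v', g', rfl, hv', hg'⟩
    exact hu' ⟨v + v', g', by rw [add_assoc], by rw [map_add]; omega, hg'⟩

lemma exists_decomposition_of_ne_zero {σ : Equiv.Perm (Fin n)} (hσ : Monotone (w ∘ σ))
    {u : Fin n →₀ ℕ} {j : ℕ} (hu : u ∈ orderGE w e (j + 1)) (hu' : u ∉ orderGE w e (j + 2))
    {s : Fin n} (hs : u s ≠ 0) :
    ∃ s' v g, σ.symm s' ≤ σ.symm s ∧ u = (Finsupp.single s' 1 + v) + g ∧
      (Finsupp.single s' 1 + v).degree = j + 1 ∧ e ≤ Finsupp.weight w g ∧ g ∉ orderGE w e 1 := by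
  obtain ⟨v, g, rfl, hv, hg, hg'⟩ := exists_decomposition hu hu'
  by_cases h : ∃ s', v s' ≠ 0 ∧ σ.symm s' ≤ σ.symm s
  · obtain ⟨s', hs', hle⟩ := h
    obtain ⟨v', rfl⟩ := exists_eq_single_add hs'
    exact ⟨s', v', g, hle, rfl, hv, hg, hg'⟩
  · push Not at h
    have hvs : v s = 0 := by
      by_contra hvs
      exact lt_irrefl _ (h s hvs)
    have hgs : g s ≠ 0 := by simpa [hvs] using hs
    obtain ⟨t, ht⟩ := exists_ne_zero_of_degree_pos (u := v) (by omega)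
    have hwt : w s ≤ w t := by simpa using hσ (h t ht).le
    obtain ⟨v', rfl⟩ := exists_eq_single_add ht
    obtain ⟨g', rfl⟩ := exists_eq_single_add hgs
    have heq : Finsupp.single t 1 + v' + (Finsupp.single s 1 + g') =
      Finsupp.single s 1 + v' + (Finsupp.single t 1 + g') := by abel
    have hg2 : e ≤ Finsupp.weight w (Finsupp.single t 1 + g') := by
      rw [map_add, Finsupp.weight_single] at hg ⊢
      simp only [one_smul] at hg ⊢
      omega
    rw [map_add, Finsupp.degree_single] at hv
    refine ⟨s, v', Finsupp.single t 1 + g', le_rfl, heq, ?_, hg2, ?_⟩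
    · rw [map_add, Finsupp.degree_single]
      omega
    · rintro ⟨v₂, g₂, h₂, hv₂, hg₂⟩
      refine hu' ⟨Finsupp.single s 1 + v' + v₂, g₂, ?_, ?_, hg₂⟩
      · rw [heq, h₂, ← add_assoc]
      · rw [map_add, map_add, Finsupp.degree_single]
        omega

/-- The minimal monomial generators of the truncation. -/
abbrev Generator (w : Fin n → ℤ) (e : ℤ) : Type :=
  {g : Fin n →₀ ℕ // e ≤ Finsupp.weight w g ∧ g ∉ orderGE w e 1}

variable {k : Type} [Field k]

/-- The polynomial obtained by substituting for each basis vector the corresponding minimal monomial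
generator of the truncation. -/
def realize (k : Type) [Field k] (w : Fin n → ℤ) (e : ℤ) :
    (Generator w e →₀ MvPolynomial (Fin n) k) →ₗ[MvPolynomial (Fin n) k] MvPolynomial (Fin n) k :=
  Finsupp.linearCombination _ fun g => monomial g.1 1

lemma realize_single (g : Generator w e) (p : MvPolynomial (Fin n) k) :
    realize k w e (Finsupp.single g p) = p * monomial g.1 1 := by
  simp [realize]

lemma mem_of_forall_monomial_mem {W : Submodule k (MvPolynomial (Fin n) k)}
    {p : MvPolynomial (Fin n) k} (h : ∀ u ∈ p.support, monomial u 1 ∈ W) : p ∈ W := by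
  rw [p.as_sum]
  refine Submodule.sum_mem _ fun u hu => ?_
  rw [← mul_one (coeff u p), ← smul_eq_mul, ← smul_monomial]
  exact W.smul_mem _ (h u hu)

lemma realize_mem_restrictSupport {j : ℕ} {f : Generator w e →₀ MvPolynomial (Fin n) k}
    (hf : comp _ j f = f) : realize k w e f ∈ restrictSupport k (orderGE w e j) := by
  rw [realize, Finsupp.linearCombination_apply]
  refine Submodule.sum_mem _ fun g _ => ?_
  rw [mem_restrictSupport_iff]
  intro u hu
  rw [Finset.mem_coe, mem_support_iff] at hu
  beta_reduce at hu
  rw [smul_eq_mul, coeff_mul_monomial'] at hu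
  split_ifs at hu with hgu
  · refine ⟨u - g.1, g.1, (tsub_add_cancel_of_le hgu).symm, ?_, g.2.1⟩
    have := isHomogeneous_of_comp_eq hf g (left_ne_zero_of_mul hu)
    rw [Finsupp.degree_eq_weight_one]
    exact this.ge
  · exact absurd rfl hu

lemma coeff_realize_of_comp_zero {f : Generator w e →₀ MvPolynomial (Fin n) k}
    (hf : comp _ 0 f = f) (g : Generator w e) :
    coeff g.1 (realize k w e f) = coeff 0 (f g) := by
  rw [realize, Finsupp.linearCombination_apply, Finsupp.sum, coeff_sum, Finset.sum_eq_single g]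
  · rw [smul_eq_mul, coeff_mul_monomial']
    simp
  · intro b _ hb
    rw [smul_eq_mul, coeff_mul_monomial']
    split_ifs with hle
    · rw [mul_one]
      have hne : g.1 - b.1 ≠ 0 := by
        intro h0
        exact hb (Subtype.ext (le_antisymm hle (tsub_eq_zero_iff_le.mp h0)))
      rw [← hf, comp_apply, homogeneousComponent_zero, coeff_C, if_neg hne.symm]
    · rfl
  · intro hg
    rw [Finsupp.notMem_support_iff.mp hg]
    simp

lemma exists_realize_sub_mem {j : ℕ} {p : MvPolynomial (Fin n) k}
    (L : Submodule k (Generator w e →₀ MvPolynomial (Fin n) k))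
    (h : ∀ u ∈ p.support, u ∈ orderGE w e (j + 1) ∨
      ∃ a ∈ L, comp _ j a = a ∧ realize k w e a = monomial u 1) :
    ∃ a ∈ L, comp _ j a = a ∧ p - realize k w e a ∈ restrictSupport k (orderGE w e (j + 1)) := by
  have hp : p ∈ restrictSupport k (orderGE w e (j + 1)) ⊔
      (L ⊓ LinearMap.ker (comp _ j - LinearMap.id)).map ((realize k w e).restrictScalars k) := by
    refine mem_of_forall_monomial_mem fun u hu => ?_
    rcases h u hu with h | ⟨a, haL, haj, hau⟩
    · refine Submodule.mem_sup_left ?_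
      rw [mem_restrictSupport_iff]
      intro v hv
      rw [Finset.mem_coe] at hv
      rwa [Finset.mem_singleton.mp (support_monomial_subset hv)]
    · exact Submodule.mem_sup_right ⟨a, ⟨haL, by simp [haj]⟩, hau⟩
  obtain ⟨q, hq, _, ⟨a, ⟨haL, haj⟩, rfl⟩, rfl⟩ := Submodule.mem_sup.mp hp
  refine ⟨a, haL, ?_, ?_⟩
  · simpa [sub_eq_zero] using haj
  · simpa using hq

theorem isLinearRelations_of_mem_iff {σ : Equiv.Perm (Fin n)} (hσ : Monotone (w ∘ σ))
    {K : Submodule (MvPolynomial (Fin n) k) (Generator w e →₀ MvPolynomial (Fin n) k)}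
    (hK : ∀ f, f ∈ K ↔ ∀ j, realize k w e (comp _ j f) ∈
      restrictSupport k (orderGE w e (j + 1))) :
    IsLinearRelations σ K where
  comp_mem f hf j := by
    rw [hK] at hf ⊢
    intro i
    rw [comp_comp]
    split_ifs with hij
    · rw [hij]
      exact hf j
    · rw [map_zero]
      exact Submodule.zero_mem _
  comp_zero f hf := by
    have h0 := (hK f).mp hf 0
    ext1 g
    rw [Finsupp.zero_apply, ← comp_comp_self, comp_apply, homogeneousComponent_zero,
      ← coeff_realize_of_comp_zero (comp_comp_self 0 f) g]
    by_contra hne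
    refine g.2.2 ((mem_restrictSupport_iff k).mp h0 ?_)
    rw [Finset.mem_coe, mem_support_iff]
    rintro hcoeff
    exact hne (by rw [hcoeff, C_0])
  mem_of_X_smul_mem i j a ha hXa := by
    obtain ⟨b, hb, c, hc, hbc⟩ := Submodule.mem_sup.mp hXa
    have hXT := congrArg (fun x => realize k w e (comp _ (j + 2) x)) hbc
    simp only [map_add] at hXT
    rw [comp_X_smul, ha, map_smul, smul_eq_mul] at hXT
    have hb' : realize k w e (comp _ (j + 2) b) ∈ varIdeal k σ i := by
      rw [realize, Finsupp.linearCombination_apply]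
      refine Ideal.sum_mem _ fun g _ => Ideal.mul_mem_right _ _ ?_
      exact (mem_varIdeal_smul_top σ).mp
        (comp_succ_mem_varIdeal_smul (fun _ _ => Submodule.mem_top) hb (j := j + 1)) g
    have hc' := (hK c).mp hc (j + 2)
    obtain ⟨a', ha'L, ha'j, ha'⟩ := exists_realize_sub_mem (j := j + 1) (p := realize k w e a)
      ((varIdeal k σ i • ⊤ : Submodule (MvPolynomial (Fin n) k) _).restrictScalars k) (by
        intro u hu
        refine or_iff_not_imp_left.mpr fun hu2 => ?_
        have hu1 : u ∈ orderGE w e (j + 1) :=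
          (mem_restrictSupport_iff k).mp (realize_mem_restrictSupport ha) hu
        have hs : ∃ s, u s ≠ 0 ∧ (σ.symm s : ℕ) < i := by
          by_contra! hs
          have hmem : Finsupp.single (σ i) 1 + u ∈ (X (σ i) * realize k w e a).support := by
            rw [mem_support_iff] at hu ⊢
            rwa [coeff_X_mul]
          rw [← hXT] at hmem
          rcases Finset.mem_union.mp (support_add hmem) with hmem | hmem
          · rw [varIdeal, mem_ideal_span_X_image] at hb'
            obtain ⟨s, hsi, hs0⟩ := hb' _ hmem
            have hne : σ i ≠ s := by
              rintro rfl
              simp at hsi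
            have := hs s (by simpa [hne] using hs0)
            have hsi' : (σ.symm s : ℕ) < i := hsi
            omega
          · refine hu2 (mem_orderGE_of_single_add (t := σ i) ?_
              ((mem_restrictSupport_iff k).mp hc' hmem))
            intro s hs0
            simpa using hσ (a := i) (b := σ.symm s) (hs s hs0)
        obtain ⟨s, hs0, hsi⟩ := hs
        obtain ⟨s', v, g, hle, rfl, hdeg, hg, hg'⟩ := exists_decomposition_of_ne_zero hσ hu1 hu2 hs0
        have hle' : (σ.symm s' : ℕ) ≤ σ.symm s := hle
        refine ⟨Finsupp.single ⟨g, hg, hg'⟩ (monomial (Finsupp.single s' 1 + v) 1), ?_, ?_, ?_⟩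
        · rw [Submodule.restrictScalars_mem, mem_varIdeal_smul_top]
          intro b
          rw [Finsupp.single_apply]
          split_ifs
          · rw [← one_mul (1 : k), ← monomial_mul]
            exact Ideal.mul_mem_right _ _ (Ideal.subset_span ⟨s', by simp; omega, rfl⟩)
          · exact Ideal.zero_mem _
        · have hmon := homogeneousComponent_of_mem (m := j + 1)
            (isHomogeneous_monomial (1 : k) hdeg)
          simp [comp, hmon]
        · rw [realize_single, monomial_mul, one_mul])
    rw [← sub_add_cancel a a', add_comm]
    refine Submodule.add_mem_sup ha'L ((hK _).mpr fun i => ?_)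
    have hsub : comp _ (j + 1) (a - a') = a - a' := by rw [map_sub, ha, ha'j]
    rw [← hsub, comp_comp]
    split_ifs with hij
    · rw [hsub, hij, map_sub]
      exact ha'
    · rw [map_zero]
      exact Submodule.zero_mem _

end Monomials
section Transport

/-- Linear resolutions can be transported along ring isomorphisms preserving linear forms. -/
lemma hasLinearResolution_of_ringEquiv {A B : Type*} [CommRing A] [CommRing B] (φ : A ≃+* B)
    {S : Set A} {T : Set B} (hST : ∀ p ∈ S, φ p ∈ T) {N : Type*} [AddCommGroup N] [Module A N]
    [Module B N] (hφ : ∀ (a : A) (x : N), a • x = φ a • x) (h : HasLinearResolution A S N) :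
    HasLinearResolution B T N := by
  obtain ⟨κ, d, ε, hε, h0, hd, hlin⟩ := h
  let E : ∀ κ : Type, (κ →₀ A) ≃+ (κ →₀ B) := fun κ => Finsupp.mapRange.addEquiv φ.toAddEquiv
  have hE : ∀ (κ : Type) (b : B) (f : κ →₀ B),
      (E κ).symm (b • f) = φ.symm b • (E κ).symm f := by
    intro κ b f
    ext1 i
    simp [E]
  have hE' : ∀ (κ : Type) (a : A) (f : κ →₀ A), E κ (a • f) = φ a • E κ f := by
    intro κ b f
    ext1 i
    simp [E]
  let d' : ∀ i, (κ (i + 1) →₀ B) →ₗ[B] (κ i →₀ B) := fun i =>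
    { toFun := fun f => E _ (d i ((E _).symm f))
      map_add' := fun f g => by simp
      map_smul' := fun b f => by simp [hE, hE'] }
  have hd' : ∀ i f, d' i f = E _ (d i ((E _).symm f)) := fun _ _ => rfl
  let ε' : (κ 0 →₀ B) →ₗ[B] N :=
    { toFun := fun f => ε ((E _).symm f)
      map_add' := fun f g => by simp
      map_smul' := fun b f => by simp [hE, hφ] }
  have hε' : ∀ f, ε' f = ε ((E _).symm f) := fun _ => rfl
  have hrange : ∀ i f, f ∈ LinearMap.range (d' i) ↔ (E _).symm f ∈ LinearMap.range (d i) := by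
    intro i f
    constructor
    · rintro ⟨g, rfl⟩
      exact ⟨(E _).symm g, by rw [hd', AddEquiv.symm_apply_apply]⟩
    · rintro ⟨g, hg⟩
      exact ⟨E _ g, by rw [hd', AddEquiv.symm_apply_apply, hg, AddEquiv.apply_symm_apply]⟩
  refine ⟨κ, d', ε', ?_, ?_, ?_, ?_⟩
  · intro x
    obtain ⟨f, rfl⟩ := hε x
    exact ⟨E _ f, by rw [hε', AddEquiv.symm_apply_apply]⟩
  · ext1 f
    rw [hrange, h0, LinearMap.mem_ker, LinearMap.mem_ker, hε']
  · intro i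
    ext1 f
    rw [hrange, hd, LinearMap.mem_ker, LinearMap.mem_ker, hd',
      EmbeddingLike.map_eq_zero_iff (f := E (κ i))]
  · intro i a b
    have hs : (E _).symm (Finsupp.single a (1 : B)) = Finsupp.single a 1 := by
      simp [E]
    rw [hd', hs]
    have := hST _ (hlin i a b)
    simpa [E] using this

end Transport

section AssociatedGraded

variable {k : Type} [Field k] {n : ℕ}

lemma mem_maxIdeal_pow {j : ℕ} {p : MvPolynomial (Fin n) k} :
    p ∈ maxIdeal k n ^ j ↔ ∀ u ∈ p.support, j ≤ u.degree :=
  mem_pow_idealOfVars_iff j p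

lemma X_mem_maxIdeal (s : Fin n) : (X s : MvPolynomial (Fin n) k) ∈ maxIdeal k n :=
  Ideal.subset_span ⟨s, rfl⟩

lemma algebraMap_mem_grIdeal {a : MvPolynomial (Fin n) k} (ha : a ∈ maxIdeal k n) :
    algebraMap (MvPolynomial (Fin n) k) (reesAlgebra (maxIdeal k n)) a ∈ grIdeal k n :=
  Ideal.mem_map_of_mem _ ha

lemma mem_grIdeal {r : reesAlgebra (maxIdeal k n)} :
    r ∈ grIdeal k n ↔ ∀ j, r.1.coeff j ∈ maxIdeal k n ^ (j + 1) := by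
  constructor
  · intro hr
    induction hr using Submodule.span_induction with
    | mem x hx =>
      obtain ⟨s, hs, rfl⟩ := hx
      intro j
      change (Polynomial.C s).coeff j ∈ _
      rw [Polynomial.coeff_C]
      split_ifs with hj
      · simpa [hj] using hs
      · exact Ideal.zero_mem _
    | zero => simp
    | add x y _ _ hx hy =>
      intro j
      simpa using Ideal.add_mem _ (hx j) (hy j)
    | smul a x _ hx =>
      intro j
      change (a.1 * x.1).coeff j ∈ _
      rw [Polynomial.coeff_mul]
      refine Ideal.sum_mem _ fun q hq => ?_
      rw [← Finset.HasAntidiagonal.mem_antidiagonal.mp hq, add_assoc, pow_add]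
      exact Ideal.mul_mem_mul ((mem_reesAlgebra_iff _ _).mp a.2 q.1) (hx q.2)
  · intro h
    have key : ∀ j, ∀ s ∈ maxIdeal k n ^ (j + 1),
        ∃ hs : Polynomial.monomial j s ∈ reesAlgebra (maxIdeal k n),
          (⟨_, hs⟩ : reesAlgebra (maxIdeal k n)) ∈ grIdeal k n := by
      intro j s hs
      rw [pow_succ'] at hs
      induction hs using Submodule.mul_induction_on' with
      | mem_mul_mem a ha b hb =>
        have hb' := reesAlgebra.monomial_mem.mpr hb
        refine ⟨reesAlgebra.monomial_mem.mpr (Ideal.mul_mem_left _ a hb), ?_⟩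
        have hmem := Ideal.mul_mem_right ⟨_, hb'⟩ _ (algebraMap_mem_grIdeal ha)
        convert hmem using 1
        apply Subtype.ext
        change _ = Polynomial.C a * Polynomial.monomial j b
        rw [Polynomial.C_mul_monomial]
      | add x _ y _ hx hy =>
        obtain ⟨hx1, hx2⟩ := hx
        obtain ⟨hy1, hy2⟩ := hy
        refine ⟨by rw [map_add]; exact add_mem hx1 hy1, ?_⟩
        convert Ideal.add_mem _ hx2 hy2 using 1
        apply Subtype.ext
        simp
    choose h1 h2 using key
    have hr : r = ∑ j ∈ r.1.support, ⟨_, h1 j _ (h j)⟩ := by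
      apply Subtype.ext
      rw [AddSubmonoidClass.coe_finsetSum]
      exact r.1.as_sum_support
    rw [hr]
    exact Ideal.sum_mem _ fun j _ => h2 j _ (h j)

/-- The ring homomorphism from the polynomial ring to the Rees algebra of its maximal ideal placing
a homogeneous polynomial of degree `j` in degree `j`. -/
def toRees (k : Type) [Field k] (n : ℕ) :
    MvPolynomial (Fin n) k →+* reesAlgebra (maxIdeal k n) :=
  eval₂Hom ((algebraMap (MvPolynomial (Fin n) k) (reesAlgebra (maxIdeal k n))).comp C)
    fun s => ⟨Polynomial.monomial 1 (X s),
      reesAlgebra.monomial_mem.mpr (by simpa using X_mem_maxIdeal s)⟩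

lemma coeff_toRees (p : MvPolynomial (Fin n) k) (j : ℕ) :
    (toRees k n p).1.coeff j = homogeneousComponent j p := by
  induction p using MvPolynomial.induction_on generalizing j with
  | C a =>
    have : (toRees k n (C a)).1 = Polynomial.C (C a) := by
      rw [toRees, coe_eval₂Hom, eval₂_C]
      rfl
    rw [this, Polynomial.coeff_C, homogeneousComponent_of_mem (isHomogeneous_C _ a)]
  | add p q hp hq =>
    rw [map_add, map_add, ← hp, ← hq]
    exact Polynomial.coeff_add _ _ _
  | mul_X p s hp =>
    have : (toRees k n (p * X s)).1 = (toRees k n p).1 * Polynomial.monomial 1 (X s) := by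
      rw [map_mul]
      simp [toRees]
    rw [this, homogeneousComponent_mul_of_isHomogeneous (isHomogeneous_X k s),
      ← Polynomial.C_mul_X_pow_eq_monomial, ← mul_assoc, Polynomial.coeff_mul_X_pow']
    split_ifs
    · rw [Polynomial.coeff_mul_C, hp]
    · rfl

/-- The homomorphism from the polynomial ring to the associated graded ring. -/
def toGr (k : Type) [Field k] (n : ℕ) : MvPolynomial (Fin n) k →+* GrRing k n :=
  (Ideal.Quotient.mk (grIdeal k n)).comp (toRees k n)

lemma toGr_bijective : Function.Bijective (toGr k n) := by
  constructor
  · rw [injective_iff_map_eq_zero]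
    intro p hp
    have hp' : toRees k n p ∈ grIdeal k n := Ideal.Quotient.eq_zero_iff_mem.mp hp
    rw [mem_grIdeal] at hp'
    ext u
    by_contra hu
    have hcoeff : coeff u (homogeneousComponent u.degree p) = coeff u p := by
      rw [coeff_homogeneousComponent, if_pos rfl]
    have := hp' u.degree
    rw [coeff_toRees, mem_maxIdeal_pow] at this
    have := this u (by rw [mem_support_iff, hcoeff]; exact hu)
    omega
  · intro x
    obtain ⟨r, rfl⟩ := Ideal.Quotient.mk_surjective x
    refine ⟨∑ j ∈ r.1.support, homogeneousComponent j (r.1.coeff j), ?_⟩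
    rw [toGr, RingHom.comp_apply, Ideal.Quotient.mk_eq_mk_iff_sub_mem, mem_grIdeal]
    intro j
    change ((toRees k n _).1 - r.1).coeff j ∈ _
    rw [Polynomial.coeff_sub, coeff_toRees, map_sum]
    have hsum : ∑ i ∈ r.1.support, homogeneousComponent j (homogeneousComponent i (r.1.coeff i)) =
        homogeneousComponent j (r.1.coeff j) := by
      rw [Finset.sum_eq_single j]
      · rw [homogeneousComponent_of_mem (homogeneousComponent_isHomogeneous j _), if_pos rfl]
      · intro i _ hij
        rw [homogeneousComponent_of_mem (homogeneousComponent_isHomogeneous i _), if_neg hij.symm]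
      · intro hj
        rw [Polynomial.notMem_support_iff.mp hj]
        simp
    rw [hsum, mem_maxIdeal_pow]
    intro u hu
    have hr := mem_maxIdeal_pow.mp ((mem_reesAlgebra_iff _ _).mp r.2 j) u
    rw [mem_support_iff, coeff_sub, coeff_homogeneousComponent] at hu
    split_ifs at hu with h
    · simp at hu
    · have := hr (by rw [mem_support_iff]; simpa using hu)
      omega

/-- The associated graded ring of a polynomial ring is the polynomial ring. -/
def grEquiv (k : Type) [Field k] (n : ℕ) : MvPolynomial (Fin n) k ≃+* GrRing k n :=
  RingEquiv.ofBijective (toGr k n) toGr_bijective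

lemma grEquiv_mem_grDeg1 {p : MvPolynomial (Fin n) k} (hp : p.IsHomogeneous 1) :
    grEquiv k n p ∈ grDeg1 k n := by
  have hpm : p ∈ maxIdeal k n := by
    rw [← pow_one (maxIdeal k n), mem_maxIdeal_pow]
    intro u hu
    have := hp (mem_support_iff.mp hu)
    rw [Finsupp.degree_eq_weight_one]
    exact this.ge
  refine ⟨p, hpm, ?_⟩
  change Ideal.Quotient.mk _ (toRees k n p) = _
  congr 1
  apply Subtype.ext
  ext1 j
  rw [coeff_toRees, Polynomial.coeff_monomial, homogeneousComponent_of_mem hp]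
  simp only [eq_comm]

variable {M : Type} [AddCommGroup M] [Module (MvPolynomial (Fin n) k) M]

/-- The degree `j` coefficient of an element of the Rees module. -/
def reesCoeff (x : ReesMod k n M) (j : ℕ) : M := PolynomialModule.coeff x.1 j

lemma reesCoeff_mem (x : ReesMod k n M) (j : ℕ) :
    reesCoeff x j ∈ maxIdeal k n ^ j • (⊤ : Submodule (MvPolynomial (Fin n) k) M) :=
  x.2 j

lemma reesCoeff_add (x y : ReesMod k n M) (j : ℕ) :
    reesCoeff (x + y) j = reesCoeff x j + reesCoeff y j := rfl

lemma reesCoeff_sub (x y : ReesMod k n M) (j : ℕ) :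
    reesCoeff (x - y) j = reesCoeff x j - reesCoeff y j := rfl

lemma reesCoeff_zero (j : ℕ) : reesCoeff (0 : ReesMod k n M) j = 0 := rfl

lemma reesCoeff_smul (r : reesAlgebra (maxIdeal k n)) (x : ReesMod k n M) (j : ℕ) :
    reesCoeff (r • x) j =
      ∑ q ∈ Finset.HasAntidiagonal.antidiagonal j, r.1.coeff q.1 • reesCoeff x q.2 :=
  PolynomialModule.smul_apply r.1 x.1 j

/-- The homogeneous element of the Rees module with given coefficient. -/
def reesSingle (j : ℕ) (y : M)
    (hy : y ∈ maxIdeal k n ^ j • (⊤ : Submodule (MvPolynomial (Fin n) k) M)) : ReesMod k n M :=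
  ⟨PolynomialModule.single _ j y, by
    rw [Ideal.Filtration.mem_submodule]
    intro i
    rw [PolynomialModule.coeff_single, Finsupp.single_apply]
    split_ifs with h
    · rw [← h]; exact hy
    · exact Submodule.zero_mem _⟩

lemma reesCoeff_reesSingle (j i : ℕ) (y : M)
    (hy : y ∈ maxIdeal k n ^ j • (⊤ : Submodule (MvPolynomial (Fin n) k) M)) :
    reesCoeff (reesSingle j y hy) i = if j = i then y else 0 :=
  PolynomialModule.lsingle_apply j y i

lemma reesMod_ext {x y : ReesMod k n M} (h : ∀ j, reesCoeff x j = reesCoeff y j) : x = y :=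
  Subtype.ext (PolynomialModule.coeff_injective (Finsupp.ext h))

lemma mem_grIdeal_smul_top {x : ReesMod k n M} :
    x ∈ grIdeal k n • (⊤ : Submodule (reesAlgebra (maxIdeal k n)) (ReesMod k n M)) ↔
      ∀ j, reesCoeff x j ∈
        maxIdeal k n ^ (j + 1) • (⊤ : Submodule (MvPolynomial (Fin n) k) M) := by
  constructor
  · intro hx
    induction hx using Submodule.smul_induction_on' with
    | smul r hr m _ =>
      intro j
      rw [reesCoeff_smul]
      refine Submodule.sum_mem _ fun q hq => ?_
      rw [← Finset.HasAntidiagonal.mem_antidiagonal.mp hq, add_right_comm, pow_add,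
        Submodule.mul_smul]
      exact Submodule.smul_mem_smul (mem_grIdeal.mp hr q.1) (reesCoeff_mem m q.2)
    | add x _ y _ hx hy =>
      intro j
      rw [reesCoeff_add]
      exact Submodule.add_mem _ (hx j) (hy j)
  · intro h
    have key : ∀ j, ∀ y ∈ maxIdeal k n ^ (j + 1) • (⊤ : Submodule (MvPolynomial (Fin n) k) M),
        ∃ hy, reesSingle j y hy ∈
          grIdeal k n • (⊤ : Submodule (reesAlgebra (maxIdeal k n)) (ReesMod k n M)) := by
      intro j y hy
      rw [pow_succ', Submodule.mul_smul] at hy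
      induction hy using Submodule.smul_induction_on' with
      | smul a ha b hb =>
        refine ⟨Submodule.smul_mem _ _ hb, ?_⟩
        convert Submodule.smul_mem_smul (algebraMap_mem_grIdeal ha)
          (Submodule.mem_top (x := reesSingle j b hb)) using 1
        apply reesMod_ext
        intro i
        rw [reesCoeff_smul, Finset.sum_eq_single (0, i)]
        · rw [reesCoeff_reesSingle, reesCoeff_reesSingle]
          change _ = (Polynomial.C a).coeff 0 • _
          rw [Polynomial.coeff_C_zero]
          split_ifs <;> simp
        · intro q hq hne
          have hq0 : q.1 ≠ 0 := by
            intro h0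
            rw [Finset.HasAntidiagonal.mem_antidiagonal, h0, zero_add] at hq
            exact hne (Prod.ext h0 hq)
          change (Polynomial.C a).coeff q.1 • _ = _
          rw [Polynomial.coeff_C_of_ne_zero hq0, zero_smul]
        · intro hnot
          simp at hnot
      | add x _ y _ hx hy =>
        obtain ⟨hx1, hx2⟩ := hx
        obtain ⟨hy1, hy2⟩ := hy
        refine ⟨Submodule.add_mem _ hx1 hy1, ?_⟩
        convert Submodule.add_mem _ hx2 hy2 using 1
        apply reesMod_ext
        intro i
        rw [reesCoeff_add, reesCoeff_reesSingle, reesCoeff_reesSingle, reesCoeff_reesSingle]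
        split_ifs <;> simp
    choose h1 h2 using key
    have hx : x = ∑ j ∈ (PolynomialModule.coeff x.1).support,
        reesSingle j (reesCoeff x j) (h1 j _ (h j)) := by
      apply reesMod_ext
      intro i
      have hsum : ∀ (s : Finset ℕ) (f : ℕ → ReesMod k n M),
          reesCoeff (∑ j ∈ s, f j) i = ∑ j ∈ s, reesCoeff (f j) i := fun s f =>
        map_sum (AddMonoidHom.mk' (fun x : ReesMod k n M => reesCoeff x i)
          fun x y => reesCoeff_add x y i) f s
      simp only [hsum, reesCoeff_reesSingle]
      rw [Finset.sum_ite_eq']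
      split_ifs with hi
      · rfl
      · exact Finsupp.notMem_support_iff.mp hi
    rw [hx]
    exact Submodule.sum_mem _ fun j _ => h2 j _ (h j)

/-- The class in the associated graded module of an element of the Rees module. -/
def grMk (x : ReesMod k n M) : GrMod k n M := Submodule.Quotient.mk x

lemma grMk_surjective : Function.Surjective (grMk : ReesMod k n M → GrMod k n M) :=
  Submodule.Quotient.mk_surjective _

lemma grMk_add (x y : ReesMod k n M) : grMk (x + y) = grMk x + grMk y := rfl

lemma grMk_zero : grMk (0 : ReesMod k n M) = 0 := rfl

lemma grMk_eq_grMk {x y : ReesMod k n M} : grMk x = grMk y ↔ ∀ j, reesCoeff x j - reesCoeff y j ∈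
    maxIdeal k n ^ (j + 1) • (⊤ : Submodule (MvPolynomial (Fin n) k) M) := by
  simp_rw [← reesCoeff_sub]
  rw [← mem_grIdeal_smul_top]
  exact Submodule.Quotient.eq _

end AssociatedGraded
section Truncation

variable {k : Type} [Field k] {n : ℕ} {w : Fin n → ℤ} {e : ℤ}

lemma monomial_mem_trunc {g : Fin n →₀ ℕ} (hg : e ≤ Finsupp.weight w g) (c : k) :
    monomial g c ∈ trunc k n w e :=
  Submodule.subset_span (Set.mem_iUnion₂.mpr ⟨_, hg, isWeightedHomogeneous_monomial w g c rfl⟩)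

lemma mul_mem_orderGE {p q : MvPolynomial (Fin n) k} {i : ℕ} (hp : p ∈ maxIdeal k n ^ i)
    (hq : q ∈ restrictSupport k {u | e ≤ Finsupp.weight w u}) :
    p * q ∈ restrictSupport k (orderGE w e i) := by
  classical
  rw [mem_restrictSupport_iff] at hq ⊢
  intro u hu
  obtain ⟨v, hv, g, hg, rfl⟩ := Finset.mem_add.mp (support_mul p q hu)
  exact ⟨v, g, rfl, mem_maxIdeal_pow.mp hp v hv, hq hg⟩

lemma mem_restrictSupport_of_mem_trunc (hw : ∀ i, 0 < w i) {f : MvPolynomial (Fin n) k}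
    (hf : f ∈ trunc k n w e) : f ∈ restrictSupport k {u | e ≤ Finsupp.weight w u} := by
  induction hf using Submodule.span_induction with
  | mem x hx =>
    obtain ⟨d, hd, hx⟩ := Set.mem_iUnion₂.mp hx
    rw [mem_restrictSupport_iff]
    intro u hu
    exact hd.trans_eq (hx (mem_support_iff.mp hu)).symm
  | zero => exact Submodule.zero_mem _
  | add x y _ _ hx hy => exact Submodule.add_mem _ hx hy
  | smul a x _ hx =>
    have h := mul_mem_orderGE (i := 0) (p := a) (by simp) hx
    rw [smul_eq_mul]
    rw [mem_restrictSupport_iff] at h ⊢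
    intro u hu
    obtain ⟨v, g, rfl, -, hg⟩ := h hu
    have hv : 0 ≤ Finsupp.weight w v := by
      rw [Finsupp.weight_apply]
      exact Finset.sum_nonneg fun i _ => nsmul_nonneg (hw i).le _
    rw [Set.mem_ofPred_eq, map_add]
    omega

lemma mem_maxIdeal_pow_smul_trunc (hw : ∀ i, 0 < w i) {f : MvPolynomial (Fin n) k} {i : ℕ} :
    f ∈ maxIdeal k n ^ i • trunc k n w e ↔ f ∈ restrictSupport k (orderGE w e i) := by
  constructor
  · intro hf
    induction hf using Submodule.smul_induction_on' with
    | smul r hr m hm => exact mul_mem_orderGE hr (mem_restrictSupport_of_mem_trunc hw hm)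
    | add x _ y _ hx hy => exact Submodule.add_mem _ hx hy
  · intro hf
    rw [mem_restrictSupport_iff] at hf
    rw [f.as_sum]
    refine Submodule.sum_mem _ fun u hu => ?_
    obtain ⟨v, g, rfl, hv, hg⟩ := hf hu
    rw [← one_mul (coeff (v + g) f), ← monomial_mul, ← smul_eq_mul]
    refine Submodule.smul_mem_smul (mem_maxIdeal_pow.mpr fun u hu => ?_) (monomial_mem_trunc hg _)
    rwa [Finset.mem_singleton.mp (support_monomial_subset hu)]

lemma mem_maxIdeal_pow_smul_top (hw : ∀ i, 0 < w i) {x : trunc k n w e} {i : ℕ} :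
    x ∈ maxIdeal k n ^ i • (⊤ : Submodule (MvPolynomial (Fin n) k) (trunc k n w e)) ↔
      x.1 ∈ restrictSupport k (orderGE w e i) := by
  rw [← mem_maxIdeal_pow_smul_trunc hw]
  have h : (maxIdeal k n ^ i • (⊤ : Submodule (MvPolynomial (Fin n) k) (trunc k n w e))).map
      (trunc k n w e).subtype = maxIdeal k n ^ i • trunc k n w e := by
    rw [Submodule.map_smul'', Submodule.map_top, Submodule.range_subtype]
  rw [← h]
  exact (Function.Injective.mem_set_image (trunc k n w e).injective_subtype).symm

/-- The generator of the associated graded module of the truncation attached to a minimal monomial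
generator. -/
def grGenerator (k : Type) [Field k] (w : Fin n → ℤ) (e : ℤ) (g : Generator w e) :
    ReesMod k n (trunc k n w e) :=
  reesSingle 0 ⟨monomial g.1 1, monomial_mem_trunc g.2.1 1⟩ (by simp)

/-- The associated graded module of the truncation as a module over the polynomial ring. -/
abbrev grModule (k : Type) [Field k] (n : ℕ) (w : Fin n → ℤ) (e : ℤ) :
    Module (MvPolynomial (Fin n) k) (GrMod k n (trunc k n w e)) :=
  Module.compHom _ (grEquiv k n).toRingHom

attribute [local instance] grModule

/-- The presentation of the associated graded module of the truncation. -/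
def grCover (k : Type) [Field k] (w : Fin n → ℤ) (e : ℤ) :
    (Generator w e →₀ MvPolynomial (Fin n) k) →ₗ[MvPolynomial (Fin n) k]
      GrMod k n (trunc k n w e) :=
  Finsupp.linearCombination _ fun g => grMk (grGenerator k w e g)

lemma exists_grCover_eq (f : Generator w e →₀ MvPolynomial (Fin n) k) :
    ∃ x : ReesMod k n (trunc k n w e), grCover k w e f = grMk x ∧
      ∀ j, (reesCoeff x j).1 = realize k w e (comp _ j f) := by
  induction f using Finsupp.induction_linear with
  | zero => exact ⟨0, by rw [map_zero, grMk_zero], fun j => by rw [map_zero, map_zero]; rfl⟩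
  | add f g hf hg =>
    obtain ⟨x, hx, hxj⟩ := hf
    obtain ⟨y, hy, hyj⟩ := hg
    refine ⟨x + y, by rw [map_add, hx, hy, grMk_add], fun j => ?_⟩
    rw [map_add, map_add, reesCoeff_add, Submodule.coe_add, hxj, hyj]
  | single g p =>
    refine ⟨toRees k n p • grGenerator k w e g, ?_, fun j => ?_⟩
    · rw [grCover, Finsupp.linearCombination_single]
      rfl
    · have hcomp : comp (Generator w e) j (Finsupp.single g p) =
          Finsupp.single g (homogeneousComponent j p) := by
        simp [comp]
      rw [hcomp, realize_single, reesCoeff_smul, Finset.sum_eq_single (j, 0)]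
      · rw [coeff_toRees, grGenerator, reesCoeff_reesSingle, if_pos rfl]
        rfl
      · intro q hq hne
        have hq0 : q.2 ≠ 0 := by
          intro h0
          rw [Finset.HasAntidiagonal.mem_antidiagonal, h0, add_zero] at hq
          exact hne (Prod.ext hq h0)
        rw [grGenerator, reesCoeff_reesSingle, if_neg hq0.symm, smul_zero]
      · intro hnot
        simp at hnot

lemma mem_ker_grCover (hw : ∀ i, 0 < w i) (f : Generator w e →₀ MvPolynomial (Fin n) k) :
    f ∈ LinearMap.ker (grCover k w e) ↔
      ∀ j, realize k w e (comp _ j f) ∈ restrictSupport k (orderGE w e (j + 1)) := by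
  obtain ⟨x, hx, hxj⟩ := exists_grCover_eq f
  rw [LinearMap.mem_ker, hx, ← grMk_zero, grMk_eq_grMk]
  refine forall_congr' fun j => ?_
  rw [reesCoeff_zero, sub_zero, mem_maxIdeal_pow_smul_top hw, hxj]

lemma grCover_surjective (hw : ∀ i, 0 < w i) : Function.Surjective (grCover k w e) := by
  intro y
  obtain ⟨x, rfl⟩ := grMk_surjective y
  have key : ∀ j, ∃ a : Generator w e →₀ MvPolynomial (Fin n) k, comp _ j a = a ∧
      (reesCoeff x j).1 - realize k w e a ∈ restrictSupport k (orderGE w e (j + 1)) := by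
    intro j
    obtain ⟨a, -, ha⟩ := exists_realize_sub_mem (k := k) (w := w) (e := e) (j := j)
      (p := (reesCoeff x j).1) ⊤ (by
        intro u hu
        refine or_iff_not_imp_left.mpr fun hu' => ?_
        obtain ⟨v, g, rfl, hv, hg, hg'⟩ := exists_decomposition ((mem_restrictSupport_iff k).mp
          ((mem_maxIdeal_pow_smul_top hw).mp (reesCoeff_mem x j)) hu) hu'
        refine ⟨Finsupp.single ⟨g, hg, hg'⟩ (monomial v 1), Submodule.mem_top, ?_, ?_⟩
        · have hmon := homogeneousComponent_of_mem (m := j) (isHomogeneous_monomial (1 : k) hv)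
          simp [comp, hmon]
        · rw [realize_single, monomial_mul, one_mul])
    exact ⟨a, ha⟩
  choose a ha ha' using key
  refine ⟨∑ j ∈ (PolynomialModule.coeff x.1).support, a j, ?_⟩
  obtain ⟨z, hz, hzj⟩ := exists_grCover_eq (∑ j ∈ (PolynomialModule.coeff x.1).support, a j)
  rw [hz, eq_comm, grMk_eq_grMk]
  intro j
  rw [mem_maxIdeal_pow_smul_top hw, Submodule.coe_sub, hzj, map_sum]
  have hcomp : ∀ i, comp _ j (a i) = if j = i then a i else 0 := by
    intro i
    conv_lhs => rw [← ha i, comp_comp, ha i]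
  simp only [hcomp]
  rw [Finset.sum_ite_eq]
  split_ifs with hj
  · exact ha' j
  · have hx0 : reesCoeff x j = 0 := Finsupp.notMem_support_iff.mp hj
    rw [hx0, map_zero, Submodule.coe_zero, sub_zero]
    exact Submodule.zero_mem _

theorem hasLinearResolution_grMod_trunc (hw : ∀ i, 0 < w i) :
    HasLinearResolution (GrRing k n) (grDeg1 k n) (GrMod k n (trunc k n w e)) :=
  hasLinearResolution_of_ringEquiv (grEquiv k n) (fun _ hp => grEquiv_mem_grDeg1 hp)
    (fun _ _ => rfl)
    ((isLinearRelations_of_mem_iff (Tuple.monotone_sort w) (mem_ker_grCover hw)).hasLinearResolution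
      (grCover k w e) (grCover_surjective hw) rfl)

end Truncation

end LinearTruncation

/-- **Theorem A.** Truncations of a (possibly nonstandard) positively `ℤ`-graded
polynomial ring are nonstandard Koszul: for every `e`, the associated graded module
`gr_m(S_{≥e})` has a linear resolution over the standard graded ring `gr_m(S)`. -/
theorem truncation_nonstandard_koszul (k : Type) [Field k] (n : ℕ)
    (w : Fin n → ℤ) (hw : ∀ i, 0 < w i) (e : ℤ) :
    HasLinearResolution (GrRing k n) (grDeg1 k n) (GrMod k n ↥(trunc k n w e)) :=
  LinearTruncation.hasLinearResolution_grMod_trunc hw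
end
end

section
/- Let S = k[x_1,…,x_n] be a (possibly nonstandard) positively Z-graded polynomial ring over a field k with graded maximal ideal m = (x_1,…,x_n). If M = S(a_1) ⊕ ⋯ ⊕ S(a_j) is any finitely generated graded free S-module, then for every integer e the truncation M_{≥e} is a nonstandard Koszul S-module; that is, gr_m(M_{≥e}) has a linear resolution over gr_m(S). -/
/-!
Background setup.  `MvPolynomial (Fin n) k` is the polynomial ring `S = k[x_1, …, x_n]`
over the field `k`, graded (possibly nonstandardly) by weights `w : Fin n → ℤ` with
`0 < w i`, with graded maximal ideal `m = maxIdeal k n = (x_1, …, x_n)`.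

* `trunc k n w e` is the truncation `S_{≥e} = ⊕_{i ≥ e} S_i`, an `S`-submodule of `S`
  (realized as the `S`-span of the weighted-homogeneous elements of weighted degree `≥ e`;
  for positive weights this span is exactly `⊕_{i ≥ e} S_i`).
* `GrRing k n` is the associated graded ring `gr_m(S) = ⊕_{i≥0} m^i/m^{i+1}`, realized
  as the quotient `Rees(m) ⧸ m·Rees(m)` of the Rees algebra of `m`; it is a standard
  graded polynomial ring over `k = S/m`.
* `GrMod k n M` is the associated graded module `gr_m(M) = ⊕_{i≥0} m^i M/m^{i+1} M` of an
  `S`-module `M`, realized as the quotient of the Rees module `⊕_i m^i M` by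
  `m·(⊕_i m^i M)`; it is a module over `gr_m(S) = GrRing k n`.
* `grDeg1 k n` is the degree-one component `m/m²` of `gr_m(S)`, i.e. the set of linear
  forms of the standard graded ring `gr_m(S)`.
* `HasLinearResolution R Lin N` says that `N` admits a free resolution
  `⋯ → F_{i+1} → F_i → ⋯ → F_0 → N → 0` in which every differential is given by a matrix
  all of whose entries lie in the set `Lin` of linear forms.  For a module generated in
  degree `0` over a standard graded `k`-algebra `R` (with `Lin = R_1`) this is the usual
  notion of a linear resolution: a graded free resolution `F_•` with `F_i` generated in
  degree `i`.
-/

set_option synthInstance.maxHeartbeats 1000000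
set_option maxHeartbeats 1000000

noncomputable section
open MvPolynomial

variable (k : Type) [Field k] (n : ℕ) (M : Type) [AddCommGroup M]
  [Module (MvPolynomial (Fin n) k) M]

/-- Ring-theoretic properties of linear forms in a polynomial ring: `x` are variables, `Lin` is a
group of linear forms, and there are projections onto degrees one and two. -/
structure IsPolynomialLike {R : Type} [CommRing R] {n : ℕ} (x : Fin n → R)
    (Lin : AddSubgroup R) : Prop where
  x_mem : ∀ v, x v ∈ Lin
  colon : ∀ (A : Set (Fin n)) (v : Fin n) (r : R), v ∉ A →
    r * x v ∈ Ideal.span (x '' A) → r ∈ Ideal.span (x '' A)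
  exists_proj : ∃ π₁ π₂ : R →+ R, (∀ r, π₁ r ∈ Lin) ∧
    (∀ r, ∀ s ∈ Lin, π₂ (r * s) = π₁ r * s) ∧ (∀ r ∈ Lin, π₁ r = r)

/-- A well-ordered family of elements of `N` such that the successive colon ideals are generated by
variables, with witnessing relations having linear coefficients. -/
structure LinearQuotients {R : Type} [CommRing R] {n : ℕ} (x : Fin n → R)
    (Lin : AddSubgroup R) (N : Type) [AddCommGroup N] [Module R N] where
  κ : Type
  [ord : LinearOrder κ]
  [wf : WellFoundedLT κ]
  u : κ → N
  V : κ → Set (Fin n)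
  rel : ∀ i, ∀ v ∈ V i, ∃ c ∈ Finsupp.supported R R (Set.Iio i), (∀ j, c j ∈ Lin) ∧
    x v • u i = Finsupp.linearCombination R u c
  colon : ∀ i (r : R), r • u i ∈ Submodule.span R (u '' Set.Iio i) → r ∈ Ideal.span (x '' V i)

namespace LinearQuotients

variable {R : Type} [CommRing R] {n : ℕ} {x : Fin n → R} {Lin : AddSubgroup R}
  {N : Type} [AddCommGroup N] [Module R N] (D : LinearQuotients x Lin N)

instance : LinearOrder D.κ := D.ord
instance : WellFoundedLT D.κ := D.wf

/-- The index type of the first syzygies. -/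
abbrev SyzIndex : Type := {p : D.κ ×ₗ Fin n // (ofLex p).2 ∈ D.V (ofLex p).1}

/-- The index in the original family of the leading term of a syzygy. -/
def lead (p : D.SyzIndex) : D.κ := (ofLex p.1).1

/-- The variable in the leading term of a syzygy. -/
def leadVar (p : D.SyzIndex) : Fin n := (ofLex p.1).2

lemma leadVar_mem (p : D.SyzIndex) : D.leadVar p ∈ D.V (D.lead p) := p.2

/-- The tail of the syzygy with a given leading term. -/
def tail (p : D.SyzIndex) : D.κ →₀ R := (D.rel _ _ (D.leadVar_mem p)).choose

lemma tail_mem_supported (p : D.SyzIndex) :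
    D.tail p ∈ Finsupp.supported R R (Set.Iio (D.lead p)) :=
  (D.rel _ _ (D.leadVar_mem p)).choose_spec.1

lemma tail_mem (p : D.SyzIndex) (j) : D.tail p j ∈ Lin :=
  (D.rel _ _ (D.leadVar_mem p)).choose_spec.2.1 j

lemma linearCombination_tail (p : D.SyzIndex) :
    Finsupp.linearCombination R D.u (D.tail p) = x (D.leadVar p) • D.u (D.lead p) :=
  (D.rel _ _ (D.leadVar_mem p)).choose_spec.2.2.symm

/-- The linear syzygies of a family with linear quotients. -/
def syz (p : D.SyzIndex) : D.κ →₀ R :=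
  Finsupp.single (D.lead p) (x (D.leadVar p)) - D.tail p

lemma linearCombination_syz (p : D.SyzIndex) :
    Finsupp.linearCombination R D.u (D.syz p) = 0 := by
  simp [syz, linearCombination_tail]

lemma eq_zero_of_mem_supported {i a : D.κ} {c : D.κ →₀ R}
    (hc : c ∈ Finsupp.supported R R (Set.Iio i)) (h : i ≤ a) : c a = 0 := by
  by_contra h0
  exact absurd ((Finsupp.mem_supported R c).1 hc (Finsupp.mem_support_iff.2 h0))
    (not_lt.2 h)

lemma syz_apply_of_lt (p : D.SyzIndex) {a : D.κ} (h : D.lead p < a) : D.syz p a = 0 := by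
  simp [syz, D.eq_zero_of_mem_supported (D.tail_mem_supported p) h.le, h.ne]

lemma syz_apply_lead (p : D.SyzIndex) : D.syz p (D.lead p) = x (D.leadVar p) := by
  simp [syz, D.eq_zero_of_mem_supported (D.tail_mem_supported p) le_rfl]

lemma syz_mem (hx : IsPolynomialLike x Lin) (p : D.SyzIndex) (a : D.κ) : D.syz p a ∈ Lin := by
  classical
  rw [syz, Finsupp.sub_apply, Finsupp.single_apply]
  refine sub_mem ?_ (D.tail_mem p a)
  split_ifs
  · exact hx.x_mem _
  · exact zero_mem _

lemma span_syz_le_ker (A : Set D.SyzIndex) :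
    Submodule.span R (D.syz '' A) ≤ LinearMap.ker (Finsupp.linearCombination R D.u) := by
  rw [Submodule.span_le]
  rintro _ ⟨p, -, rfl⟩
  exact D.linearCombination_syz p

lemma exists_sub_mem_supported (j : D.κ) (r : R) (hr : r ∈ Ideal.span (x '' D.V j)) :
    ∃ y ∈ Submodule.span R (D.syz '' {p | D.lead p ≤ j}),
      Finsupp.single j r - y ∈ Finsupp.supported R R (Set.Iio j) := by
  induction hr using Submodule.span_induction with
  | mem r hr =>
    obtain ⟨v, hv, rfl⟩ := hr
    let p : D.SyzIndex := ⟨toLex (j, v), hv⟩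
    refine ⟨D.syz p, Submodule.subset_span ⟨p, le_refl j, rfl⟩, ?_⟩
    have : Finsupp.single j (x v) - D.syz p = D.tail p := sub_sub_cancel _ _
    rw [this]
    exact D.tail_mem_supported p
  | zero => exact ⟨0, zero_mem _, by simp⟩
  | add r s _ _ hr hs =>
    obtain ⟨y, hy, hy'⟩ := hr
    obtain ⟨z, hz, hz'⟩ := hs
    refine ⟨y + z, add_mem hy hz, ?_⟩
    rw [Finsupp.single_add, add_sub_add_comm]
    exact add_mem hy' hz'
  | smul a r _ hr =>
    obtain ⟨y, hy, hy'⟩ := hr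
    refine ⟨a • y, Submodule.smul_mem _ a hy, ?_⟩
    rw [← Finsupp.smul_single, ← smul_sub]
    exact Submodule.smul_mem _ a hy'

lemma mem_span_syz_of_le (j : D.κ) (z : D.κ →₀ R)
    (hz : z ∈ Finsupp.supported R R (Set.Iic j))
    (h0 : Finsupp.linearCombination R D.u z = 0) :
    z ∈ Submodule.span R (D.syz '' {p | D.lead p ≤ j}) := by
  classical
  induction j using WellFoundedLT.induction generalizing z with
  | ind j ih =>
    have hz' : z - Finsupp.single j (z j) ∈ Finsupp.supported R R (Set.Iio j) := by
      rw [Finsupp.mem_supported]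
      intro a ha
      have ha' : (z - Finsupp.single j (z j)) a ≠ 0 := Finsupp.mem_support_iff.1 ha
      by_cases haj : j = a
      · subst haj
        simp at ha'
      · simp [haj] at ha'
        exact lt_of_le_of_ne ((Finsupp.mem_supported R z).1 hz
          (Finsupp.mem_support_iff.2 ha')) (Ne.symm haj)
    have hzj : z j ∈ Ideal.span (x '' D.V j) := by
      refine D.colon j _ ?_
      rw [Finsupp.mem_span_image_iff_linearCombination]
      refine ⟨-(z - Finsupp.single j (z j)), neg_mem hz', ?_⟩
      simp [h0]
    obtain ⟨y, hy, hy'⟩ := D.exists_sub_mem_supported j _ hzj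
    have hzy : z - y ∈ Finsupp.supported R R (Set.Iio j) := by
      have := add_mem hz' hy'
      rwa [sub_add_sub_cancel] at this
    have hzy0 : Finsupp.linearCombination R D.u (z - y) = 0 := by
      rw [map_sub, h0, show Finsupp.linearCombination R D.u y = 0 from D.span_syz_le_ker _ hy,
        sub_zero]
    suffices h : z - y ∈ Submodule.span R (D.syz '' {p | D.lead p ≤ j}) by
      simpa using add_mem h hy
    by_cases hne : z - y = 0
    · rw [hne]
      exact zero_mem _
    · have hs : (z - y).support.Nonempty := Finsupp.support_nonempty_iff.2 hne
      have hlt : (z - y).support.max' hs < j :=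
        (Finsupp.mem_supported R _).1 hzy (Finset.max'_mem _ hs)
      refine Submodule.span_mono (Set.image_mono ?_) (ih _ hlt (z - y) ?_ hzy0)
      · exact fun p hp => le_trans hp hlt.le
      · rw [Finsupp.mem_supported]
        exact fun a ha => Finset.le_max' _ a ha

lemma span_syz_eq_ker :
    Submodule.span R (Set.range D.syz) = LinearMap.ker (Finsupp.linearCombination R D.u) := by
  apply le_antisymm
  · rw [← Set.image_univ]
    exact D.span_syz_le_ker _
  · intro z hz
    by_cases hne : z = 0
    · rw [hne]
      exact zero_mem _
    · have hs : z.support.Nonempty := Finsupp.support_nonempty_iff.2 hne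
      refine Submodule.span_mono (Set.image_subset_range _ _)
        (D.mem_span_syz_of_le (z.support.max' hs) z ?_ hz)
      rw [Finsupp.mem_supported]
      exact fun a ha => Finset.le_max' _ a ha

lemma range_linearCombination_syz :
    LinearMap.range (Finsupp.linearCombination R D.syz) =
      LinearMap.ker (Finsupp.linearCombination R D.u) := by
  rw [Finsupp.range_linearCombination, span_syz_eq_ker]

lemma linearCombination_syz_single_mem (hx : IsPolynomialLike x Lin) (p : D.SyzIndex) (a : D.κ) :
    Finsupp.linearCombination R D.syz (Finsupp.single p 1) a ∈ Lin := by
  rw [Finsupp.linearCombination_single, one_smul]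
  exact D.syz_mem hx p a

lemma linearCombination_surjective (hD : Submodule.span R (Set.range D.u) = ⊤) :
    Function.Surjective (Finsupp.linearCombination R D.u) := by
  rw [← LinearMap.range_eq_top, Finsupp.range_linearCombination, hD]

lemma exists_linear_relation (hx : IsPolynomialLike x Lin) {p p' : D.SyzIndex}
    (hl : D.lead p' = D.lead p) (hlt : p' < p) :
    ∃ c ∈ Finsupp.supported R R (Set.Iio p), (∀ q, c q ∈ Lin) ∧
      x (D.leadVar p') • D.syz p = Finsupp.linearCombination R D.syz c := by
  classical
  obtain ⟨π₁, π₂, h₁, h₂, h₃⟩ := hx.exists_proj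
  set z := x (D.leadVar p') • D.syz p - x (D.leadVar p) • D.syz p' with hz
  have hzlt : z ∈ Finsupp.supported R R (Set.Iio (D.lead p)) := by
    rw [Finsupp.mem_supported]
    intro a ha
    by_contra h
    rcases (not_lt.1 h).eq_or_lt with h | h
    · subst h
      have e := D.syz_apply_lead p'
      rw [hl] at e
      apply Finsupp.mem_support_iff.1 ha
      simp [hz, syz_apply_lead, e, mul_comm]
    · apply Finsupp.mem_support_iff.1 ha
      simp [hz, D.syz_apply_of_lt p h, D.syz_apply_of_lt p' (hl.trans_lt h)]
  have hz0 : Finsupp.linearCombination R D.u z = 0 := by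
    simp [hz, linearCombination_syz]
  have hπz : ∀ a, π₂ (z a) = z a := by
    intro a
    simp [hz, h₂ _ _ (D.syz_mem hx _ _), h₃ _ (hx.x_mem _)]
  obtain ⟨l, hl', hlz⟩ : ∃ l ∈ Finsupp.supported R R (Set.Iio p),
      Finsupp.linearCombination R D.syz l = z := by
    by_cases hne : z = 0
    · exact ⟨0, zero_mem _, by simp [hne]⟩
    have hs : z.support.Nonempty := Finsupp.support_nonempty_iff.2 hne
    have hjlt : z.support.max' hs < D.lead p :=
      (Finsupp.mem_supported R _).1 hzlt (Finset.max'_mem _ hs)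
    have hmem := D.mem_span_syz_of_le (z.support.max' hs) z (by
      rw [Finsupp.mem_supported]
      exact fun a ha => Finset.le_max' _ a ha) hz0
    rw [← Finsupp.mem_span_image_iff_linearCombination]
    refine Submodule.span_mono (Set.image_mono ?_) hmem
    intro q hq
    exact Subtype.coe_lt_coe.1 (Prod.Lex.lt_iff.2 (Or.inl (lt_of_le_of_lt hq hjlt)))
  refine ⟨l.mapRange π₁ (map_zero _) + Finsupp.single p' (x (D.leadVar p)), ?_, ?_, ?_⟩
  · refine add_mem ?_ (Finsupp.single_mem_supported R _ hlt)
    rw [Finsupp.mem_supported] at hl' ⊢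
    exact fun q hq => hl' (Finsupp.support_mapRange hq)
  · intro q
    rw [Finsupp.add_apply, Finsupp.mapRange_apply, Finsupp.single_apply]
    refine add_mem (h₁ _) ?_
    split_ifs
    · exact hx.x_mem _
    · exact zero_mem _
  · have key : Finsupp.linearCombination R D.syz (l.mapRange π₁ (map_zero _)) = z := by
      ext a
      rw [← hπz a, ← hlz, Finsupp.linearCombination_apply, Finsupp.linearCombination_apply,
        Finsupp.sum_mapRange_index (by simp)]
      simp only [Finsupp.sum, Finsupp.finsetSum_apply, map_sum, Finsupp.smul_apply, smul_eq_mul]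
      exact Finset.sum_congr rfl fun q _ => (h₂ _ _ (D.syz_mem hx q a)).symm
    rw [map_add, key, Finsupp.linearCombination_single, hz, sub_add_cancel]

/-- The syzygies of a family with linear quotients again have linear quotients. -/
def next (hx : IsPolynomialLike x Lin) : LinearQuotients x Lin (D.κ →₀ R) where
  κ := D.SyzIndex
  u := D.syz
  V p := {v | v ∈ D.V (D.lead p) ∧ v < D.leadVar p}
  rel p v hv := D.exists_linear_relation hx (p := p) (p' := ⟨toLex (D.lead p, v), hv.1⟩) rfl
    (Subtype.coe_lt_coe.1 (Prod.Lex.lt_iff.2 (Or.inr ⟨rfl, hv.2⟩)))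
  colon p r hr := by
    refine hx.colon _ (D.leadVar p) _ (fun h => lt_irrefl _ h.2) ?_
    have := Submodule.mem_map_of_mem (f := Finsupp.lapply (R := R) (M := R) (D.lead p)) hr
    rw [Submodule.map_span, ← Set.image_comp] at this
    rw [map_smul, Finsupp.lapply_apply, syz_apply_lead, smul_eq_mul] at this
    refine Submodule.span_le.2 ?_ this
    rintro _ ⟨q, hq, rfl⟩
    rcases Prod.Lex.lt_iff.1 (Subtype.coe_lt_coe.2 hq) with h | ⟨h, h'⟩
    · change D.syz q (D.lead p) ∈ _
      rw [D.syz_apply_of_lt q (a := D.lead p) h]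
      exact zero_mem _
    · have e : D.lead q = D.lead p := h
      change D.syz q (D.lead p) ∈ _
      rw [← e, D.syz_apply_lead]
      exact Ideal.subset_span ⟨D.leadVar q, ⟨D.leadVar_mem q, h'⟩, rfl⟩

end LinearQuotients

/-- A module together with a family having linear quotients. -/
structure LinearQuotientsStage {R : Type} [CommRing R] {n : ℕ} (x : Fin n → R)
    (Lin : AddSubgroup R) where
  N : Type
  [grp : AddCommGroup N]
  [mod : Module R N]
  data : LinearQuotients x Lin N

namespace LinearQuotientsStage

variable {R : Type} [CommRing R] {n : ℕ} {x : Fin n → R} {Lin : AddSubgroup R}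

instance (T : LinearQuotientsStage x Lin) : AddCommGroup T.N := T.grp
instance (T : LinearQuotientsStage x Lin) : Module R T.N := T.mod

/-- Pass from a family to its linear syzygies. -/
def next (hx : IsPolynomialLike x Lin) (T : LinearQuotientsStage x Lin) :
    LinearQuotientsStage x Lin where
  N := T.data.κ →₀ R
  data := T.data.next hx

/-- The iterated syzygies of a family with linear quotients. -/
def iter (hx : IsPolynomialLike x Lin) (T : LinearQuotientsStage x Lin) :
    ℕ → LinearQuotientsStage x Lin
  | 0 => T
  | i + 1 => (iter hx T i).next hx

end LinearQuotientsStage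

lemma LinearQuotients.hasLinearResolution {R : Type} [CommRing R] {n : ℕ} {x : Fin n → R}
    {Lin : AddSubgroup R} (hx : IsPolynomialLike x Lin) {N : Type} [AddCommGroup N] [Module R N]
    (D : LinearQuotients x Lin N) (hD : Submodule.span R (Set.range D.u) = ⊤)
    {L : Set R} (hL : (Lin : Set R) ⊆ L) : HasLinearResolution R L N := by
  let T := LinearQuotientsStage.iter hx ⟨N, D⟩
  exact ⟨fun i => (T i).data.κ,
    fun i => Finsupp.linearCombination R (T i).data.syz,
    Finsupp.linearCombination R D.u, D.linearCombination_surjective hD,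
    D.range_linearCombination_syz,
    fun i => (T (i + 1)).data.range_linearCombination_syz,
    fun i a b => hL ((T i).data.linearCombination_syz_single_mem hx a b)⟩

lemma homogeneousComponent_mul_of_isHomogeneous {σ R : Type*} [CommRing R] (m d : ℕ)
    (r : MvPolynomial σ R) {s : MvPolynomial σ R} (hs : s.IsHomogeneous d) :
    homogeneousComponent (m + d) (r * s) = homogeneousComponent m r * s := by
  classical
  nth_rewrite 1 [← sum_homogeneousComponent r]
  rw [Finset.sum_mul, map_sum]
  have h (i : ℕ) : homogeneousComponent (m + d) (homogeneousComponent i r * s) =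
      if i = m then homogeneousComponent m r * s else 0 := by
    rw [homogeneousComponent_of_mem (((homogeneousComponent_isHomogeneous i r).mul hs))]
    split_ifs with h1 h2 h2
    · rw [h2]
    · omega
    · omega
    · rfl
  simp only [h, Finset.sum_ite_eq', Finset.mem_range]
  split_ifs with hm
  · rfl
  · rw [homogeneousComponent_eq_zero _ _ (by omega), zero_mul]

lemma MvPolynomial.isPolynomialLike (k : Type) [Field k] (n : ℕ) :
    IsPolynomialLike (X : Fin n → MvPolynomial (Fin n) k)
      (homogeneousSubmodule (Fin n) k 1).toAddSubgroup where
  x_mem v := isHomogeneous_X k v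
  colon A v r hv h := by
    rw [mem_ideal_span_X_image] at h ⊢
    intro m hm
    obtain ⟨i, hi, hi'⟩ := h (m + Finsupp.single v 1) (by
      rwa [mem_support_iff, coeff_mul_X, ← mem_support_iff])
    refine ⟨i, hi, ?_⟩
    have hvi : v ≠ i := fun h => hv (h ▸ hi)
    simpa [hvi] using hi'
  exists_proj := ⟨(homogeneousComponent 1).toAddMonoidHom, (homogeneousComponent 2).toAddMonoidHom,
    fun r => homogeneousComponent_isHomogeneous 1 r,
    fun r _ hs => homogeneousComponent_mul_of_isHomogeneous 1 1 r hs,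
    fun _ hr => homogeneousComponent_eq_self hr⟩

lemma IsPolynomialLike.map_ringEquiv {R R' : Type} [CommRing R] [CommRing R'] {n : ℕ}
    {x : Fin n → R} {Lin : AddSubgroup R} (hx : IsPolynomialLike x Lin) (E : R ≃+* R') :
    IsPolynomialLike (fun v => E (x v)) (Lin.map (E : R →+ R')) where
  x_mem v := ⟨x v, hx.x_mem v, rfl⟩
  colon A v r hv h := by
    have key (r : R') : r ∈ Ideal.span ((fun v => E (x v)) '' A) ↔
        E.symm r ∈ Ideal.span (x '' A) := by
      have e : Ideal.span ((fun v => E (x v)) '' A) = (Ideal.span (x '' A)).map (E : R →+* R') := by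
        rw [Ideal.map_span, ← Set.image_comp]
        rfl
      rw [e]
      constructor
      · intro h
        have := Ideal.mem_map_of_mem (E.symm : R' →+* R) h
        rw [Ideal.map_map] at this
        simpa using this
      · intro h
        simpa using Ideal.mem_map_of_mem (E : R →+* R') h
    rw [key] at h ⊢
    rw [map_mul, E.symm_apply_apply] at h
    exact hx.colon A v _ hv h
  exists_proj := by
    obtain ⟨π₁, π₂, h₁, h₂, h₃⟩ := hx.exists_proj
    refine ⟨((E : R →+ R').comp π₁).comp (E.symm : R' →+ R),
      ((E : R →+ R').comp π₂).comp (E.symm : R' →+ R), fun r => ⟨_, h₁ _, rfl⟩, ?_, ?_⟩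
    · rintro r _ ⟨s, hs, rfl⟩
      simp [h₂ _ s hs]
    · rintro _ ⟨s, hs, rfl⟩
      simp [h₃ s hs]

/-- The class of `x_i` in degree one of the Rees algebra. -/
def reesX (i : Fin n) : ↥(reesAlgebra (maxIdeal k n)) :=
  ⟨Polynomial.monomial 1 (X i), reesAlgebra.monomial_mem.mpr (by
    rw [pow_one]
    exact Ideal.subset_span ⟨i, rfl⟩)⟩

/-- The homomorphism from the polynomial ring to the Rees algebra sending a form `p` of degree `d`
to `p` placed in degree `d`. -/
def reesLift : MvPolynomial (Fin n) k →+* ↥(reesAlgebra (maxIdeal k n)) :=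
  eval₂Hom ((algebraMap (MvPolynomial (Fin n) k) ↥(reesAlgebra (maxIdeal k n))).comp C) (reesX k n)

lemma mem_maxIdeal_pow_iff (t : ℕ) (p : MvPolynomial (Fin n) k) :
    p ∈ maxIdeal k n ^ t ↔ ∀ α, p.coeff α ≠ 0 → t ≤ α.degree := by
  rw [show maxIdeal k n = idealOfVars (Fin n) k from rfl, mem_pow_idealOfVars_iff]
  simp [mem_support_iff]

lemma coeff_reesLift (p : MvPolynomial (Fin n) k) (t : ℕ) :
    (reesLift k n p : Polynomial (MvPolynomial (Fin n) k)).coeff t = homogeneousComponent t p := by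
  classical
  induction p using MvPolynomial.induction_on generalizing t with
  | C a =>
    rw [reesLift, coe_eval₂Hom, eval₂_C]
    change (Polynomial.C (C a)).coeff t = _
    rw [Polynomial.coeff_C, homogeneousComponent_of_mem (isHomogeneous_C _ a)]
  | add p q hp hq => simp [hp, hq]
  | mul_X p i hp =>
    have h : (reesLift k n (p * X i) : Polynomial (MvPolynomial (Fin n) k)) =
        (reesLift k n p : Polynomial (MvPolynomial (Fin n) k)) * Polynomial.monomial 1 (X i) := by
      rw [map_mul]
      simp [reesLift, reesX]
    rw [h]
    cases t with
    | zero =>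
      rw [homogeneousComponent_zero]
      simp [coeff_mul_X']
    | succ t =>
      rw [Polynomial.coeff_mul_monomial, hp,
        homogeneousComponent_mul_of_isHomogeneous t 1 p (isHomogeneous_X k i)]

lemma coeff_mem_of_mem_grIdeal (F : ↥(reesAlgebra (maxIdeal k n))) (hF : F ∈ grIdeal k n) (t : ℕ) :
    (F : Polynomial (MvPolynomial (Fin n) k)).coeff t ∈ maxIdeal k n ^ (t + 1) := by
  rw [grIdeal, Ideal.map] at hF
  induction hF using Submodule.span_induction generalizing t with
  | mem F h =>
    obtain ⟨r, hr, rfl⟩ := h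
    change (Polynomial.C r).coeff t ∈ _
    rw [Polynomial.coeff_C]
    split_ifs with h
    · subst h
      simpa using hr
    · exact zero_mem _
  | zero => simp
  | add F G _ _ hF hG =>
    rw [Subalgebra.coe_add, Polynomial.coeff_add]
    exact add_mem (hF t) (hG t)
  | smul A F _ hF =>
    rw [smul_eq_mul, Subalgebra.coe_mul, Polynomial.coeff_mul]
    refine Ideal.sum_mem _ fun ij hij => ?_
    rw [← Finset.HasAntidiagonal.mem_antidiagonal.1 hij, add_assoc, pow_add]
    exact Ideal.mul_mem_mul (A.2 _) (hF _)

/-- The canonical map from the polynomial ring to the associated graded ring. -/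
def grLift : MvPolynomial (Fin n) k →+* GrRing k n :=
  (Ideal.Quotient.mk (grIdeal k n)).comp (reesLift k n)

lemma grLift_injective : Function.Injective (grLift k n) := by
  rw [injective_iff_map_eq_zero]
  intro p hp
  have h := coeff_mem_of_mem_grIdeal k n _ (Ideal.Quotient.eq_zero_iff_mem.1 hp)
  ext α
  by_contra hα
  have := (mem_maxIdeal_pow_iff k n _ _).1 (h α.degree) α (by
    rwa [coeff_reesLift, coeff_homogeneousComponent, if_pos rfl])
  omega

lemma mk_algebraMap_mem_range (a : MvPolynomial (Fin n) k) :
    Ideal.Quotient.mk (grIdeal k n) (algebraMap _ ↥(reesAlgebra (maxIdeal k n)) a) ∈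
      (grLift k n).range := by
  refine ⟨C (a.coeff 0), ?_⟩
  rw [grLift, RingHom.comp_apply, reesLift, coe_eval₂Hom, eval₂_C, RingHom.comp_apply,
    Ideal.Quotient.mk_eq_mk_iff_sub_mem, ← map_sub]
  refine Ideal.mem_map_of_mem _ ?_
  rw [← pow_one (maxIdeal k n), mem_maxIdeal_pow_iff]
  intro α hα
  by_contra h0
  have : α = 0 := (Finsupp.degree_eq_zero_iff α).1 (by omega)
  subst this
  simp at hα

lemma grLift_surjective : Function.Surjective (grLift k n) := by
  have h1 (r : MvPolynomial (Fin n) k) (hr : r ∈ maxIdeal k n) (h) :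
      Ideal.Quotient.mk (grIdeal k n) ⟨Polynomial.monomial 1 r, h⟩ ∈ (grLift k n).range := by
    have hmem {r : MvPolynomial (Fin n) k} (hr : r ∈ Submodule.span _ (Set.range X)) :
        Polynomial.monomial 1 r ∈ reesAlgebra (maxIdeal k n) :=
      reesAlgebra.monomial_mem.mpr (by rwa [pow_one])
    rw [maxIdeal] at hr
    induction hr using Submodule.span_induction with
    | mem r hr =>
      obtain ⟨i, rfl⟩ := hr
      refine ⟨X i, ?_⟩
      simp [grLift, reesLift, reesX]
    | zero =>
      convert zero_mem (grLift k n).range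
      rw [Ideal.Quotient.eq_zero_iff_mem]
      convert zero_mem (grIdeal k n)
      exact map_zero _
    | add r s hr hs ihr ihs =>
      have := add_mem (ihr (hmem hr))
        (ihs (hmem hs))
      rw [← map_add] at this
      convert this using 2
      exact Subtype.ext (map_add _ _ _)
    | smul a r hr ih =>
      have := mul_mem (mk_algebraMap_mem_range k n a)
        (ih (hmem hr))
      rw [← map_mul] at this
      convert this using 2
      refine Subtype.ext ?_
      change Polynomial.monomial 1 (a * r) = Polynomial.C a * Polynomial.monomial 1 r
      rw [Polynomial.C_mul_monomial]
  intro y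
  obtain ⟨⟨F, hF⟩, rfl⟩ := Ideal.Quotient.mk_surjective y
  change _ ∈ (grLift k n).range
  have hF' := hF
  rw [← adjoin_monomial_eq_reesAlgebra] at hF'
  induction hF' using Algebra.adjoin_induction with
  | mem F h =>
    obtain ⟨r, hr, rfl⟩ := h
    exact h1 r hr _
  | algebraMap a => exact mk_algebraMap_mem_range k n a
  | add F G hF' hG' ihF ihG =>
    rw [adjoin_monomial_eq_reesAlgebra] at hF' hG'
    exact add_mem (ihF hF') (ihG hG')
  | mul F G hF' hG' ihF ihG =>
    rw [adjoin_monomial_eq_reesAlgebra] at hF' hG'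
    exact mul_mem (ihF hF') (ihG hG')

/-- The associated graded ring is a polynomial ring. -/
def grEquiv : MvPolynomial (Fin n) k ≃+* GrRing k n :=
  RingEquiv.ofBijective (grLift k n) ⟨grLift_injective k n, grLift_surjective k n⟩

/-- The group of linear forms of the associated graded ring. -/
def grLin : AddSubgroup (GrRing k n) :=
  (homogeneousSubmodule (Fin n) k 1).toAddSubgroup.map (grEquiv k n : MvPolynomial (Fin n) k →+ GrRing k n)

lemma isPolynomialLike_grRing :
    IsPolynomialLike (fun v => grEquiv k n (X v)) (grLin k n) :=
  (MvPolynomial.isPolynomialLike k n).map_ringEquiv (R' := GrRing k n) (grEquiv k n)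

lemma grLin_subset_grDeg1 : (grLin k n : Set (GrRing k n)) ⊆ grDeg1 k n := by
  classical
  rintro _ ⟨p, hp, rfl⟩
  have hp' : p.IsHomogeneous 1 := hp
  refine ⟨p, ?_, ?_⟩
  · rw [← pow_one (maxIdeal k n), mem_maxIdeal_pow_iff]
    exact fun α hα => le_of_not_gt fun h => hα (hp'.coeff_eq_zero (by omega))
  · change Ideal.Quotient.mk (grIdeal k n) (reesLift k n p) = _
    congr 1
    refine Subtype.ext (Polynomial.ext fun t => ?_)
    rw [coeff_reesLift, homogeneousComponent_of_mem hp', Polynomial.coeff_monomial]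
    simp only [eq_comm]

section AssociatedGraded

/-- The Rees module as a submodule of `M[t]`. -/
def reesModEquiv : ReesMod k n M ≃ₗ[↥(reesAlgebra (maxIdeal k n))]
    ↥(((maxIdeal k n).stableFiltration
      (⊤ : Submodule (MvPolynomial (Fin n) k) M)).submodule) :=
  LinearEquiv.refl _ _

/-- The quotient map from the Rees module to the associated graded module. -/
def grMk : ReesMod k n M →+ GrMod k n M :=
  (Submodule.mkQ ((grIdeal k n) •
    (⊤ : Submodule ↥(reesAlgebra (maxIdeal k n)) (ReesMod k n M)))).toAddMonoidHom

variable {k n M}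

lemma grMk_surjective : Function.Surjective (grMk k n M) :=
  Submodule.mkQ_surjective _

lemma grMk_smul (r : ↥(reesAlgebra (maxIdeal k n))) (z : ReesMod k n M) :
    grMk k n M (r • z) = Ideal.Quotient.mk (grIdeal k n) r • grMk k n M z :=
  rfl

lemma grMk_eq_zero_iff (z : ReesMod k n M) :
    grMk k n M z = 0 ↔ z ∈ (grIdeal k n) •
      (⊤ : Submodule ↥(reesAlgebra (maxIdeal k n)) (ReesMod k n M)) :=
  Submodule.Quotient.mk_eq_zero _

/-- The component in degree `t` of an element of the Rees module. -/
def reesCoeff (t : ℕ) : ReesMod k n M →+ M where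
  toFun z := (reesModEquiv k n M z).1.coeff t
  map_zero' := by simp
  map_add' y z := by simp

lemma reesCoeff_mem (t : ℕ) (z : ReesMod k n M) :
    reesCoeff t z ∈ maxIdeal k n ^ t • (⊤ : Submodule (MvPolynomial (Fin n) k) M) :=
  (reesModEquiv k n M z).2 t

lemma reesCoeff_smul (t : ℕ) (r : ↥(reesAlgebra (maxIdeal k n))) (z : ReesMod k n M) :
    reesCoeff t (r • z) = ∑ ij ∈ Finset.HasAntidiagonal.antidiagonal t,
      (r : Polynomial (MvPolynomial (Fin n) k)).coeff ij.1 • reesCoeff ij.2 z := by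
  simp only [reesCoeff, AddMonoidHom.coe_mk, ZeroHom.coe_mk, map_smul, Submodule.coe_smul]
  exact PolynomialModule.smul_apply _ _ _

/-- An element of the Rees module concentrated in degree `t`. -/
def reesSingle (t : ℕ) (f : M)
    (hf : f ∈ maxIdeal k n ^ t • (⊤ : Submodule (MvPolynomial (Fin n) k) M)) : ReesMod k n M :=
  (reesModEquiv k n M).symm ⟨PolynomialModule.single (MvPolynomial (Fin n) k) t f, by
    classical
    intro i
    rw [PolynomialModule.coeff_single, Finsupp.single_apply]
    split_ifs with h
    · exact h ▸ hf
    · exact zero_mem _⟩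

lemma reesCoeff_single (s t : ℕ) (f : M) (hf) :
    reesCoeff s (reesSingle (k := k) (n := n) t f hf) = if t = s then f else 0 := by
  classical
  simp [reesCoeff, reesSingle, Finsupp.single_apply]

lemma reesMod_ext {y z : ReesMod k n M} (h : ∀ t, reesCoeff t y = reesCoeff t z) : y = z := by
  apply (reesModEquiv k n M).injective
  apply Subtype.ext
  apply PolynomialModule.ext
  exact Finsupp.ext h

lemma monomial_smul_reesSingle (i t : ℕ) (a : MvPolynomial (Fin n) k)
    (ha : Polynomial.monomial i a ∈ reesAlgebra (maxIdeal k n)) (f : M)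
    (hf : f ∈ maxIdeal k n ^ t • (⊤ : Submodule (MvPolynomial (Fin n) k) M))
    (hf' : a • f ∈ maxIdeal k n ^ (i + t) • (⊤ : Submodule (MvPolynomial (Fin n) k) M)) :
    (⟨Polynomial.monomial i a, ha⟩ : ↥(reesAlgebra (maxIdeal k n))) • reesSingle t f hf =
      reesSingle (i + t) (a • f) hf' := by
  apply (reesModEquiv k n M).injective
  apply Subtype.ext
  rw [map_smul]
  exact PolynomialModule.monomial_smul_single i a t f

lemma reesSingle_add (t : ℕ) (f g : M) (hf) (hg) :
    reesSingle (k := k) (n := n) t (f + g) (add_mem hf hg) =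
      reesSingle t f hf + reesSingle t g hg := by
  apply (reesModEquiv k n M).injective
  apply Subtype.ext
  rw [map_add]
  exact PolynomialModule.single_add t f g

lemma reesCoeff_mem_of_mem_smul_top (z : ReesMod k n M)
    (hz : z ∈ (grIdeal k n) • (⊤ : Submodule ↥(reesAlgebra (maxIdeal k n)) (ReesMod k n M)))
    (t : ℕ) :
    reesCoeff t z ∈ maxIdeal k n ^ (t + 1) • (⊤ : Submodule (MvPolynomial (Fin n) k) M) := by
  induction hz using Submodule.smul_induction_on' with
  | smul r hr z _ =>
    rw [reesCoeff_smul]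
    refine Submodule.sum_mem _ fun ij hij => ?_
    have e : t + 1 = (ij.1 + 1) + ij.2 := by
      rw [← Finset.HasAntidiagonal.mem_antidiagonal.1 hij]
      omega
    rw [e, pow_add, Submodule.mul_smul]
    exact Submodule.smul_mem_smul (coeff_mem_of_mem_grIdeal k n r hr _) (reesCoeff_mem _ _)
  | add y _ z _ hy hz =>
    rw [map_add]
    exact add_mem hy hz

lemma maxIdeal_pow_succ_smul_le (t : ℕ) :
    maxIdeal k n ^ (t + 1) • (⊤ : Submodule (MvPolynomial (Fin n) k) M) ≤
      maxIdeal k n ^ t • ⊤ :=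
  Submodule.smul_mono_left (Ideal.pow_le_pow_right (Nat.le_succ t))

lemma grMk_reesSingle_eq_zero (t : ℕ) (f : M)
    (hf : f ∈ maxIdeal k n ^ (t + 1) • (⊤ : Submodule (MvPolynomial (Fin n) k) M)) :
    grMk k n M (reesSingle t f (maxIdeal_pow_succ_smul_le t hf)) = 0 := by
  rw [grMk_eq_zero_iff]
  have hf' := hf
  rw [pow_succ', Submodule.mul_smul] at hf'
  induction hf' using Submodule.smul_induction_on' with
  | smul a ha g hg =>
    have h0 : Polynomial.monomial 0 a ∈ reesAlgebra (maxIdeal k n) :=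
      reesAlgebra.monomial_mem.mpr (by simp)
    have h1 : (⟨Polynomial.monomial 0 a, h0⟩ : ↥(reesAlgebra (maxIdeal k n))) ∈ grIdeal k n :=
      Ideal.mem_map_of_mem (algebraMap _ _) ha
    have h2 := Submodule.smul_mem_smul h1 (Submodule.mem_top (x := reesSingle t g hg))
    rw [monomial_smul_reesSingle 0 t a h0 g hg (by
      rw [zero_add]
      exact Submodule.smul_mem _ a hg)] at h2
    simpa only [zero_add] using h2
  | add f hf1 g hg1 ihf ihg =>
    rw [← Submodule.mul_smul, ← pow_succ'] at hf1 hg1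
    have := add_mem (ihf hf1) (ihg hg1)
    rwa [← reesSingle_add] at this

/-- The degree zero class of an element of `M` in the associated graded module. -/
def grClass (f : M) : GrMod k n M := grMk k n M (reesSingle 0 f (by simp))

lemma grClass_eq_zero (f : M)
    (hf : f ∈ maxIdeal k n • (⊤ : Submodule (MvPolynomial (Fin n) k) M)) :
    grClass (k := k) (n := n) f = 0 :=
  grMk_reesSingle_eq_zero 0 f (by simpa using hf)

lemma X_smul_mem (v : Fin n) (f : M) :
    (X v : MvPolynomial (Fin n) k) • f ∈
      maxIdeal k n ^ 1 • (⊤ : Submodule (MvPolynomial (Fin n) k) M) := by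
  rw [pow_one]
  exact Submodule.smul_mem_smul (Ideal.subset_span ⟨v, rfl⟩) Submodule.mem_top

lemma grEquiv_X_smul_grClass (v : Fin n) (f : M) :
    grEquiv k n (X v) • grClass f =
      grMk k n M (reesSingle 1 ((X v : MvPolynomial (Fin n) k) • f) (X_smul_mem v f)) := by
  have h : grEquiv k n (X v) = Ideal.Quotient.mk (grIdeal k n) (reesX k n v) := by
    change Ideal.Quotient.mk (grIdeal k n) (reesLift k n (X v)) = _
    simp [reesLift]
  rw [h, grClass, ← grMk_smul]
  congr 1
  exact monomial_smul_reesSingle 1 0 (X v) _ f _ (X_smul_mem v f)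

lemma span_grClass_eq_top (W : Set M)
    (hW : Submodule.span (MvPolynomial (Fin n) k) W = ⊤) :
    Submodule.span (GrRing k n) ((grClass : M → GrMod k n M) '' W) = ⊤ := by
  have h0 (g : M) : grClass g ∈ Submodule.span (GrRing k n) ((grClass : M → GrMod k n M) '' W) := by
    have hg : g ∈ Submodule.span (MvPolynomial (Fin n) k) W := hW ▸ Submodule.mem_top
    induction hg using Submodule.span_induction with
    | mem g hg => exact Submodule.subset_span ⟨g, hg, rfl⟩
    | zero =>
      rw [grClass_eq_zero 0 (zero_mem _)]
      exact zero_mem _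
    | add f g _ _ hf hg =>
      have := add_mem hf hg
      rwa [grClass, grClass, ← map_add, ← reesSingle_add] at this
    | smul a g _ hg =>
      have h0 : Polynomial.monomial 0 a ∈ reesAlgebra (maxIdeal k n) :=
        reesAlgebra.monomial_mem.mpr (by simp)
      have := Submodule.smul_mem _ (Ideal.Quotient.mk (grIdeal k n) ⟨_, h0⟩) hg
      rw [grClass, ← grMk_smul, monomial_smul_reesSingle 0 0 a h0 g _ (by simp)] at this
      exact this
  have h1 (t : ℕ) (f : M) (hf) : grMk k n M (reesSingle t f hf) ∈
      Submodule.span (GrRing k n) ((grClass : M → GrMod k n M) '' W) := by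
    have hf' := hf
    induction hf' using Submodule.smul_induction_on' with
    | smul a ha g hg =>
      have ha' : Polynomial.monomial t a ∈ reesAlgebra (maxIdeal k n) :=
        reesAlgebra.monomial_mem.mpr ha
      have := Submodule.smul_mem _ (Ideal.Quotient.mk (grIdeal k n) ⟨_, ha'⟩) (h0 g)
      rw [grClass, ← grMk_smul, monomial_smul_reesSingle t 0 a ha' g _ (by simpa using hf)] at this
      exact this
    | add f hf1 g hg1 ihf ihg =>
      rw [reesSingle_add t f g hf1 hg1, map_add]
      exact add_mem (ihf hf1) (ihg hg1)
  rw [eq_top_iff]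
  intro y _
  obtain ⟨z, rfl⟩ := grMk_surjective y
  have hz : z = ∑ t ∈ (reesModEquiv k n M z).1.coeff.support,
      reesSingle t (reesCoeff t z) (reesCoeff_mem t z) := by
    refine reesMod_ext fun s => ?_
    rw [map_sum]
    simp only [reesCoeff_single, Finset.sum_ite_eq']
    split_ifs with h
    · rfl
    · exact Finsupp.notMem_support_iff.1 h
  rw [hz, map_sum]
  exact Submodule.sum_mem _ fun t _ => h1 t _ _

lemma exists_coeff_ne_zero_of_coeff_mul_ne_zero {σ R : Type*} [CommSemiring R]
    {p q : MvPolynomial σ R} {γ : σ →₀ ℕ} (h : coeff γ (p * q) ≠ 0) :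
    ∃ β δ, β + δ = γ ∧ coeff β p ≠ 0 ∧ coeff δ q ≠ 0 := by
  classical
  rw [coeff_mul] at h
  obtain ⟨x, hx, h0⟩ := Finset.exists_ne_zero_of_sum_ne_zero h
  exact ⟨x.1, x.2, Finset.HasAntidiagonal.mem_antidiagonal.1 hx, left_ne_zero_of_mul h0,
    right_ne_zero_of_mul h0⟩

section Truncation

variable {w : Fin n → ℤ} {j : ℕ} {c : Fin j → ℤ}

lemma weight_nonneg (hw : ∀ i, 0 < w i) (α : Fin n →₀ ℕ) : 0 ≤ Finsupp.weight w α := by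
  rw [Finsupp.weight_eq_sum]
  exact Finset.sum_nonneg fun i _ => nsmul_nonneg (hw i).le _

lemma weight_add_single (α : Fin n →₀ ℕ) (i : Fin n) :
    Finsupp.weight w (α + Finsupp.single i 1) = Finsupp.weight w α + w i := by
  simp [Finsupp.weight_single]

lemma monomial_mem_trunc {d : ℤ} {α : Fin n →₀ ℕ} (h : d ≤ Finsupp.weight w α) :
    monomial α (1 : k) ∈ trunc k n w d := by
  refine Submodule.subset_span (Set.mem_iUnion₂.2 ⟨_, h, ?_⟩)
  exact isWeightedHomogeneous_monomial w α 1 rfl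

lemma le_weight_of_mem_trunc (hw : ∀ i, 0 < w i) {d : ℤ} {f : MvPolynomial (Fin n) k}
    (hf : f ∈ trunc k n w d) {α : Fin n →₀ ℕ} (h : coeff α f ≠ 0) : d ≤ Finsupp.weight w α := by
  induction hf using Submodule.span_induction generalizing α with
  | mem f hf =>
    obtain ⟨s, hs, hf⟩ := Set.mem_iUnion₂.1 hf
    exact hs.trans_eq (hf h).symm
  | zero => simp at h
  | add f g _ _ hf hg =>
    by_cases h0 : coeff α f = 0
    · exact hg (by simpa [h0] using h)
    · exact hf h0
  | smul a g _ hg =>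
    obtain ⟨β, δ, rfl, -, h2⟩ := exists_coeff_ne_zero_of_coeff_mul_ne_zero h
    rw [map_add]
    linarith [hg h2, weight_nonneg hw β]

variable (k w c) in
/-- The direct sum of the truncations `S_{≥ c_l}`. -/
abbrev TruncFree : Type :=
  ↥(Submodule.pi (Set.univ : Set (Fin j)) (fun l => trunc k n w (c l)))

variable (w c) in
/-- The indices of the monomials in the direct sum of the truncations `S_{≥ c_l}`. -/
abbrev TruncIndex : Type :=
  {p : Fin j × (Fin n →₀ ℕ) // c p.1 ≤ Finsupp.weight w p.2}

variable (k) in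
/-- The monomials in the direct sum of the truncations `S_{≥ c_l}`. -/
def truncMonomial (p : TruncIndex w c) : TruncFree k w c :=
  ⟨Pi.single p.1.1 (monomial p.1.2 1), by
    intro l _
    by_cases h : l = p.1.1
    · subst h
      simpa using monomial_mem_trunc p.2
    · simp [h]⟩

lemma X_smul_truncMonomial (v : Fin n) (p q : TruncIndex w c) (h : q.1.1 = p.1.1)
    (h' : q.1.2 = p.1.2 + Finsupp.single v 1) :
    (X v : MvPolynomial (Fin n) k) • truncMonomial k p = truncMonomial k q := by
  apply Subtype.ext
  change (X v : MvPolynomial (Fin n) k) • Pi.single _ _ = Pi.single _ _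
  rw [← Pi.single_smul, h, h', smul_eq_mul, mul_comm, monomial_add_single, pow_one]

lemma span_truncMonomial (hw : ∀ i, 0 < w i) :
    Submodule.span (MvPolynomial (Fin n) k) (Set.range (truncMonomial k (w := w) (c := c))) = ⊤ := by
  classical
  rw [eq_top_iff]
  intro f _
  have hf (l : Fin j) (α) (h : α ∈ (f.1 l).support) : c l ≤ Finsupp.weight w α :=
    le_weight_of_mem_trunc hw (f.2 l trivial) (mem_support_iff.1 h)
  have key : f = ∑ l, ∑ α ∈ (f.1 l).support.attach,
      (C (coeff α.1 (f.1 l)) : MvPolynomial (Fin n) k) • truncMonomial k ⟨(l, α.1), hf l _ α.2⟩ := by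
    apply Subtype.ext
    funext i
    simp only [Submodule.coe_sum, Finset.sum_apply, Submodule.coe_smul, Pi.smul_apply,
      truncMonomial]
    rw [Finset.sum_eq_single i]
    · simp only [Pi.single_eq_same, smul_eq_mul, C_mul_monomial, mul_one]
      rw [Finset.sum_attach _ (fun α => monomial α (coeff α (f.1 i))), support_sum_monomial_coeff]
    · intro b _ hb
      simp [Pi.single_eq_of_ne hb.symm]
    · simp
  rw [key]
  exact Submodule.sum_mem _ fun l _ => Submodule.sum_mem _ fun α _ =>
    Submodule.smul_mem _ _ (Submodule.subset_span ⟨_, rfl⟩)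

lemma exists_degree_eq_of_mem_pow_smul_top (hw : ∀ i, 0 < w i) {t : ℕ} {f : TruncFree k w c}
    (hf : f ∈ maxIdeal k n ^ t • (⊤ : Submodule (MvPolynomial (Fin n) k) (TruncFree k w c)))
    {l : Fin j} {γ : Fin n →₀ ℕ} (h : coeff γ (f.1 l) ≠ 0) :
    ∃ δ ≤ γ, δ.degree = t ∧ c l ≤ Finsupp.weight w (γ - δ) := by
  induction hf using Submodule.smul_induction_on' with
  | smul a ha g _ =>
    obtain ⟨β, ε, rfl, h1, h2⟩ := exists_coeff_ne_zero_of_coeff_mul_ne_zero h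
    obtain ⟨δ, hδ, hd⟩ := β.exists_le_degree_eq t ((mem_maxIdeal_pow_iff k n t a).1 ha β h1)
    refine ⟨δ, hδ.trans le_self_add, hd, ?_⟩
    rw [tsub_add_eq_add_tsub hδ |>.symm, map_add]
    linarith [le_weight_of_mem_trunc hw (g.2 l trivial) h2, weight_nonneg hw (β - δ)]
  | add f _ g _ hf hg =>
    by_cases h0 : coeff γ (f.1 l) = 0
    · exact hg (by simpa [h0] using h)
    · exact hf h0

/-- If the variables dividing `β` are no heavier than those dividing a minimal monomial `α`, then
a monomial of larger degree than `β` cannot be removed from `α + β`. -/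
lemma weight_sub_lt_of_degree_eq {d : ℤ} {α β δ : Fin n →₀ ℕ}
    (hα : ∀ i, α i ≠ 0 → Finsupp.weight w α - w i < d)
    (hβ : ∀ v i, β v ≠ 0 → α i ≠ 0 → w v ≤ w i)
    (hδ : δ ≤ α + β) (hd : δ.degree = β.degree + 1) :
    Finsupp.weight w (α + β - δ) < d := by
  classical
  have hne : α.support.Nonempty := by
    rw [Finsupp.support_nonempty_iff]
    rintro rfl
    have := Finsupp.degree_mono hδ
    rw [zero_add] at this
    omega
  obtain ⟨i, hi, hmin⟩ := α.support.exists_min_image w hne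
  rw [Finsupp.mem_support_iff] at hi
  have h1 : Finsupp.weight w (α + β - δ) + Finsupp.weight w δ =
      Finsupp.weight w α + Finsupp.weight w β := by
    rw [← map_add, tsub_add_cancel_of_le hδ, map_add]
  have h2 : 0 ≤ ∑ v, ((δ v : ℤ) - β v) * (w v - w i) := by
    refine Finset.sum_nonneg fun v _ => ?_
    have h3 : δ v ≤ α v + β v := hδ v
    rcases lt_trichotomy (δ v) (β v) with h | h | h
    · have := hβ v i (by omega) hi
      exact mul_nonneg_of_nonpos_of_nonpos (by omega) (by omega)
    · simp [h]
    · have := hmin v (Finsupp.mem_support_iff.2 (by omega))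
      exact mul_nonneg (by omega) (by omega)
  have h3 : ∑ v, ((δ v : ℤ) - β v) * (w v - w i) =
      Finsupp.weight w δ - Finsupp.weight w β - ((δ.degree : ℤ) - β.degree) * w i := by
    simp only [Finsupp.weight_eq_sum, Finsupp.degree_eq_sum, Nat.cast_sum, nsmul_eq_mul,
      ← Finset.sum_sub_distrib, Finset.sum_mul]
    exact Finset.sum_congr rfl fun v _ => by ring
  have h4 := hα i hi
  rw [hd] at h3
  push_cast at h3
  linarith

variable (w c) in
/-- The indices of the minimal monomial generators of the direct sum of the truncations
`S_{≥ c_l}`. -/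
def MinIndex : Type :=
  {p : TruncIndex w c // ∀ i, p.1.2 i ≠ 0 → Finsupp.weight w p.1.2 - w i < c p.1.1}

namespace MinIndex

/-- The component containing a minimal generator. -/
abbrev comp (p : MinIndex w c) : Fin j := p.1.1.1

/-- The exponent of a minimal generator. -/
abbrev exp (p : MinIndex w c) : Fin n →₀ ℕ := p.1.1.2

/-- The sorting key of a minimal generator: first the component, then the exponents of the
variables, by increasing weight. -/
def key (p : MinIndex w c) : Fin j ×ₗ Lex (Fin n → ℕ) :=
  toLex (p.comp, toLex fun i => p.exp (Tuple.sort w i))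

lemma key_injective : Function.Injective (key : MinIndex w c → _) := by
  intro p q h
  rw [key, key, toLex_inj, Prod.mk.injEq, toLex_inj] at h
  apply Subtype.ext
  apply Subtype.ext
  refine Prod.ext h.1 (Finsupp.ext fun v => ?_)
  simpa using congrFun h.2 ((Tuple.sort w).symm v)

instance : LinearOrder (MinIndex w c) := LinearOrder.lift' key key_injective

lemma lt_iff (p q : MinIndex w c) : p < q ↔ p.comp < q.comp ∨ p.comp = q.comp ∧
    ∃ i, (∀ i' < i, p.exp (Tuple.sort w i') = q.exp (Tuple.sort w i')) ∧
      p.exp (Tuple.sort w i) < q.exp (Tuple.sort w i) :=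
  Prod.Lex.toLex_lt_toLex

instance : WellFoundedLT (MinIndex w c) :=
  ⟨InvImage.wf key wellFounded_lt⟩

/-- The variables strictly later in the sorted order than some variable dividing the generator. -/
def vars (p : MinIndex w c) : Set (Fin n) :=
  {v | ∃ v₀, p.exp v₀ ≠ 0 ∧ (Tuple.sort w).symm v₀ < (Tuple.sort w).symm v}

lemma le_of_notMem_vars {p : MinIndex w c} {v i : Fin n} (hv : v ∉ p.vars) (hi : p.exp i ≠ 0) :
    (Tuple.sort w).symm v ≤ (Tuple.sort w).symm i :=
  not_lt.1 fun h => hv ⟨i, hi, h⟩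

lemma weight_le_of_rank_le {v i : Fin n}
    (h : (Tuple.sort w).symm v ≤ (Tuple.sort w).symm i) : w v ≤ w i := by
  simpa using Tuple.monotone_sort w h

lemma degree_tsub_ne_of_lt {p q : MinIndex w c} (hqp : q < p) (hc : q.comp = p.comp)
    {β : Fin n →₀ ℕ} (hβ : ∀ v, β v ≠ 0 → v ∉ p.vars) (hle : q.exp ≤ p.exp + β) :
    (p.exp + β - q.exp).degree ≠ β.degree := by
  intro h
  obtain h0 | ⟨-, i, hi, hlt⟩ := (lt_iff q p).1 hqp
  · exact absurd hc h0.ne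
  have h1 : (p.exp + β - q.exp).degree + q.exp.degree = p.exp.degree + β.degree := by
    rw [← map_add, tsub_add_cancel_of_le hle, map_add]
  have h2 : q.exp.degree < p.exp.degree := by
    simp only [Finsupp.degree_eq_sum]
    refine Finset.sum_lt_sum (fun v _ => ?_) ⟨_, Finset.mem_univ _, hlt⟩
    obtain ⟨s, rfl⟩ := (Tuple.sort w).surjective v
    rcases lt_trichotomy s i with hs | rfl | hs
    · exact (hi s hs).le
    · exact hlt.le
    · have h3 : β (Tuple.sort w s) = 0 := by
        by_contra h3
        have := le_of_notMem_vars (hβ _ h3) (i := Tuple.sort w i) (by omega)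
        simp only [Equiv.symm_apply_apply] at this
        exact absurd this (not_le.2 hs)
      simpa [h3] using hle (Tuple.sort w s)
  omega

end MinIndex

variable (k) in
/-- The class of a minimal monomial generator in the associated graded module. -/
def minClass (p : MinIndex w c) : GrMod k n (TruncFree k w c) :=
  grClass (truncMonomial k p.1)

lemma truncMonomial_mem_of_not_minimal (q : TruncIndex w c)
    (hq : ¬ ∀ i, q.1.2 i ≠ 0 → Finsupp.weight w q.1.2 - w i < c q.1.1) :
    truncMonomial k q ∈ maxIdeal k n •
      (⊤ : Submodule (MvPolynomial (Fin n) k) (TruncFree k w c)) := by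
  push Not at hq
  obtain ⟨i, hi, hle⟩ := hq
  have h : q.1.2 = (q.1.2 - Finsupp.single i 1) + Finsupp.single i 1 :=
    (tsub_add_cancel_of_le (Finsupp.single_le_iff.2 (by omega))).symm
  have hw' := weight_add_single (w := w) (q.1.2 - Finsupp.single i 1) i
  rw [← h] at hw'
  rw [← X_smul_truncMonomial i ⟨(q.1.1, q.1.2 - Finsupp.single i 1), by
    change c q.1.1 ≤ Finsupp.weight w (q.1.2 - Finsupp.single i 1)
    linarith⟩ q rfl h]
  exact Submodule.smul_mem_smul (Ideal.subset_span ⟨i, rfl⟩) Submodule.mem_top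

lemma span_minClass (hw : ∀ i, 0 < w i) :
    Submodule.span (GrRing k n) (Set.range (minClass k (w := w) (c := c))) = ⊤ := by
  rw [eq_top_iff, ← span_grClass_eq_top _ (span_truncMonomial hw), Submodule.span_le]
  rintro _ ⟨_, ⟨q, rfl⟩, rfl⟩
  by_cases hq : ∀ i, q.1.2 i ≠ 0 → Finsupp.weight w q.1.2 - w i < c q.1.1
  · exact Submodule.subset_span ⟨⟨q, hq⟩, rfl⟩
  · rw [grClass_eq_zero _ (truncMonomial_mem_of_not_minimal q hq)]
    exact zero_mem _

lemma minClass_rel (hw : ∀ i, 0 < w i) (p : MinIndex w c) (v : Fin n) (hv : v ∈ p.vars) :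
    ∃ f ∈ Finsupp.supported (GrRing k n) (GrRing k n) (Set.Iio p), (∀ q, f q ∈ grLin k n) ∧
      grEquiv k n (X v) • minClass k p =
        Finsupp.linearCombination (GrRing k n) (minClass k) f := by
  classical
  obtain ⟨v₀, hv₀, hlt⟩ := hv
  have hsplit : (p.exp - Finsupp.single v₀ 1) + Finsupp.single v₀ 1 = p.exp :=
    tsub_add_cancel_of_le (Finsupp.single_le_iff.2 (by omega))
  have hle : w v₀ ≤ w v := MinIndex.weight_le_of_rank_le hlt.le
  have h1 := weight_add_single (w := w) (p.exp - Finsupp.single v₀ 1) v₀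
  have h2 := weight_add_single (w := w) (p.exp - Finsupp.single v₀ 1) v
  rw [hsplit] at h1
  let q : TruncIndex w c := ⟨(p.comp, p.exp - Finsupp.single v₀ 1 + Finsupp.single v 1), by
    have := p.1.2
    change c p.comp ≤ Finsupp.weight w (_ + _)
    change c p.comp ≤ Finsupp.weight w p.exp at this
    linarith⟩
  have hq : (X v : MvPolynomial (Fin n) k) • truncMonomial k p.1 =
      (X v₀ : MvPolynomial (Fin n) k) • truncMonomial k q := by
    let s : TruncIndex w c := ⟨(p.comp, p.exp + Finsupp.single v 1), by
      change c p.comp ≤ Finsupp.weight w (p.exp + Finsupp.single v 1)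
      have h3 := weight_add_single (w := w) p.exp v
      have h4 := p.1.2
      change c p.comp ≤ Finsupp.weight w p.exp at h4
      linarith [hw v]⟩
    rw [X_smul_truncMonomial v p.1 s rfl rfl, X_smul_truncMonomial v₀ q s rfl (by
      change p.exp + _ = _ - _ + _ + _
      rw [add_right_comm, hsplit])]
  by_cases hmin : ∀ i, q.1.2 i ≠ 0 → Finsupp.weight w q.1.2 - w i < c q.1.1
  · let q' : MinIndex w c := ⟨q, hmin⟩
    refine ⟨Finsupp.single q' (grEquiv k n (X v₀)), ?_, fun r => ?_, ?_⟩
    · refine Finsupp.single_mem_supported _ _ ((MinIndex.lt_iff _ _).2 (Or.inr ⟨rfl, ?_⟩))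
      have hne : v₀ ≠ v := by
        rintro rfl
        exact lt_irrefl _ hlt
      refine ⟨(Tuple.sort w).symm v₀, fun i hi => ?_, ?_⟩
      · have hi₀ : v₀ ≠ Tuple.sort w i := by
          rintro rfl
          simp at hi
        have hi₁ : v ≠ Tuple.sort w i := by
          rintro rfl
          simp only [Equiv.symm_apply_apply] at hlt
          exact lt_asymm hi hlt
        change (p.exp - Finsupp.single v₀ 1 + Finsupp.single v 1 : Fin n →₀ ℕ) (Tuple.sort w i) = _
        simp [hi₀, hi₁]
      · change (p.exp - Finsupp.single v₀ 1 + Finsupp.single v 1 : Fin n →₀ ℕ) _ < _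
        simp only [Equiv.apply_symm_apply, Finsupp.add_apply, Finsupp.tsub_apply,
          Finsupp.single_eq_same, Finsupp.single_eq_of_ne hne, add_zero]
        omega
    · rw [Finsupp.single_apply]
      split_ifs
      · exact (isPolynomialLike_grRing k n).x_mem v₀
      · exact zero_mem _
    · rw [Finsupp.linearCombination_single, minClass, minClass, grEquiv_X_smul_grClass,
        grEquiv_X_smul_grClass]
      simp only [hq, q']
  · refine ⟨0, zero_mem _, fun _ => zero_mem _, ?_⟩
    rw [map_zero, minClass, grEquiv_X_smul_grClass]
    refine grMk_reesSingle_eq_zero 1 _ ?_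
    rw [hq, pow_succ', Submodule.mul_smul, pow_one]
    exact Submodule.smul_mem_smul (Ideal.subset_span ⟨v₀, rfl⟩)
      (truncMonomial_mem_of_not_minimal q hmin)

/-- An element in the span of a set of minimal generators lifts to an element of the Rees module
whose monomials are multiples, of the correct degree, of these generators. -/
lemma exists_lift_of_mem_span_minClass (A : Set (MinIndex w c))
    {y : GrMod k n (TruncFree k w c)}
    (hy : y ∈ Submodule.span (GrRing k n) (minClass k '' A)) :
    ∃ z, grMk k n (TruncFree k w c) z = y ∧ ∀ t l γ, coeff γ ((reesCoeff t z).1 l) ≠ 0 →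
      ∃ q ∈ A, q.comp = l ∧ q.exp ≤ γ ∧ (γ - q.exp).degree = t := by
  classical
  induction hy using Submodule.span_induction with
  | mem y hy =>
    obtain ⟨q, hq, rfl⟩ := hy
    refine ⟨_, rfl, fun t l γ h => ⟨q, hq, ?_⟩⟩
    rw [reesCoeff_single] at h
    split_ifs at h with h0
    · subst h0
      by_cases hl : q.comp = l
      · subst hl
        simp only [truncMonomial, Pi.single_eq_same, coeff_monomial, ne_eq, ite_eq_right_iff,
          one_ne_zero, imp_false, not_not] at h
        subst h
        simp
      · simp [truncMonomial, Pi.single_eq_of_ne (Ne.symm hl)] at h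
    · simp at h
  | zero => exact ⟨0, map_zero _, fun t l γ h => by simp at h⟩
  | add x y _ _ hx hy =>
    obtain ⟨x, rfl, hx⟩ := hx
    obtain ⟨y, rfl, hy⟩ := hy
    refine ⟨x + y, map_add _ _ _, fun t l γ h => ?_⟩
    by_cases h0 : coeff γ ((reesCoeff t x).1 l) = 0
    · exact hy t l γ (by simpa [h0] using h)
    · exact hx t l γ h0
  | smul r y _ hy =>
    obtain ⟨y, rfl, hy⟩ := hy
    obtain ⟨p, rfl⟩ := (grEquiv k n).surjective r
    refine ⟨reesLift k n p • y, rfl, fun t l γ h => ?_⟩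
    rw [reesCoeff_smul, Submodule.coe_sum, Finset.sum_apply, coeff_sum] at h
    obtain ⟨ij, hij, h⟩ := Finset.exists_ne_zero_of_sum_ne_zero h
    rw [coeff_reesLift] at h
    obtain ⟨β, ε, rfl, h1, h2⟩ := exists_coeff_ne_zero_of_coeff_mul_ne_zero h
    obtain ⟨q, hq, hl, hle, hd⟩ := hy _ _ _ h2
    have hβ : β.degree = ij.1 := by
      rw [coeff_homogeneousComponent] at h1
      by_contra h0
      simp [h0] at h1
    refine ⟨q, hq, hl, hle.trans le_add_self, ?_⟩
    rw [add_tsub_assoc_of_le hle, map_add, hβ, hd]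
    exact Finset.HasAntidiagonal.mem_antidiagonal.1 hij

lemma minClass_colon (hw : ∀ i, 0 < w i) (p : MinIndex w c) (r : GrRing k n)
    (hr : r • minClass k p ∈ Submodule.span (GrRing k n) (minClass k '' Set.Iio p)) :
    r ∈ Ideal.span ((fun v => grEquiv k n (X v)) '' p.vars) := by
  classical
  obtain ⟨f, rfl⟩ := (grEquiv k n).surjective r
  suffices h : f ∈ Ideal.span ((X : Fin n → MvPolynomial (Fin n) k) '' p.vars) by
    have := Ideal.mem_map_of_mem (grEquiv k n : MvPolynomial (Fin n) k →+* GrRing k n) h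
    rw [Ideal.map_span, Set.image_image] at this
    exact this
  rw [mem_ideal_span_X_image]
  intro β hβ
  by_contra! hvars
  have hβ' (v) (hv : β v ≠ 0) : v ∉ p.vars := fun h => hv (hvars v h)
  obtain ⟨z, hz, hzc⟩ := exists_lift_of_mem_span_minClass _ hr
  have hp : (truncMonomial k p.1).1 p.comp = monomial p.exp 1 := Pi.single_eq_same _ _
  let x := reesSingle (k := k) (n := n) 0 (truncMonomial k p.1) (by simp)
  have hx : grMk k n (TruncFree k w c) (reesLift k n f • x - z) = 0 := by
    rw [map_sub, hz]
    exact sub_self _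
  have hmem := reesCoeff_mem_of_mem_smul_top _ ((grMk_eq_zero_iff _).1 hx) β.degree
  have hz0 : coeff (p.exp + β) ((reesCoeff β.degree z).1 p.comp) = 0 := by
    by_contra h
    obtain ⟨q, hq, hl, hle, hd⟩ := hzc _ _ _ h
    exact MinIndex.degree_tsub_ne_of_lt hq hl hβ' hle hd
  have hx0 : coeff (p.exp + β) ((reesCoeff β.degree (reesLift k n f • x)).1 p.comp) =
      coeff β f := by
    rw [reesCoeff_smul, Finset.sum_eq_single (β.degree, 0)]
    · rw [reesCoeff_single, if_pos rfl, coeff_reesLift]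
      rw [Submodule.coe_smul, Pi.smul_apply, smul_eq_mul, hp, add_comm,
        coeff_mul_monomial, coeff_homogeneousComponent, if_pos rfl, mul_one]
    · intro ij hij hne
      rw [reesCoeff_single, if_neg, smul_zero]
      intro h0
      have := Finset.HasAntidiagonal.mem_antidiagonal.1 hij
      exact hne (Prod.ext (by omega) h0.symm)
    · intro h
      exact absurd (Finset.HasAntidiagonal.mem_antidiagonal.2 (add_zero _)) h
  obtain ⟨δ, hδ, hd, hle⟩ := exists_degree_eq_of_mem_pow_smul_top hw hmem
    (l := p.comp) (γ := p.exp + β) (by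
      rw [map_sub, Submodule.coe_sub, Pi.sub_apply, coeff_sub, hz0, hx0, sub_zero]
      exact mem_support_iff.1 hβ)
  exact absurd hle (not_le.2 (weight_sub_lt_of_degree_eq p.2 (fun v i hv hi =>
    MinIndex.weight_le_of_rank_le (MinIndex.le_of_notMem_vars (hβ' v hv) hi)) hδ hd))

variable (k c) in
/-- The minimal monomial generators have linear quotients in the associated graded module. -/
def linearQuotients (hw : ∀ i, 0 < w i) :
    LinearQuotients (fun v => grEquiv k n (X v)) (grLin k n) (GrMod k n (TruncFree k w c)) where
  κ := MinIndex w c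
  u := minClass k
  V := MinIndex.vars
  rel := minClass_rel hw
  colon := minClass_colon hw

end Truncation

end AssociatedGraded

/-- Truncations of finitely generated graded **free** modules are nonstandard Koszul.
The graded free module `M = S(a_1) ⊕ ⋯ ⊕ S(a_j)` is realized as `Fin j → S`; since
`S(a)_i = S_{a+i}`, its truncation `M_{≥e} = S_{≥ a_1+e} ⊕ ⋯ ⊕ S_{≥ a_j+e}` is the
submodule of tuples whose `l`-th coordinate lies in `S_{≥ a_l + e}`.  The conclusion is
that `gr_m(M_{≥e})` has a linear resolution over `gr_m(S)`. -/
theorem truncation_of_free_module_nonstandard_koszul (k : Type) [Field k] (n : ℕ)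
    (w : Fin n → ℤ) (hw : ∀ i, 0 < w i) (j : ℕ) (a : Fin j → ℤ) (e : ℤ) :
    HasLinearResolution (GrRing k n) (grDeg1 k n)
      (GrMod k n ↥(Submodule.pi (Set.univ : Set (Fin j))
        (fun l => trunc k n w (a l + e)))) := by
  exact (linearQuotients k (fun l => a l + e) hw).hasLinearResolution (R := GrRing k n)
    (isPolynomialLike_grRing k n) (span_minClass hw) (grLin_subset_grDeg1 k n)
end
end
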